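/- arXiv:math/0005202 — 2 statements merged into one kernel-verified Lean document; each statement's English description precedes it below -/
import Mathlib

section
/- Let X ⊂ P^r be an integral non-degenerate n-dimensional variety with dim G_{1,2}(X) < 3n + 2 and dim S_1(X) = 2n < r. Then X is a cone. -/
open Submodule

noncomputable section

/-- Polynomial functions on a complex module: the subalgebra of functions generated by
the linear functionals. -/
def PolyFun (W : Type*) [AddCommGroup W] [Module ℂ W] : Subalgebra ℂ (W → ℂ) :=
  Algebra.adjoin ℂ {f : W → ℂ | IsLinearMap ℂ f}

/-- A subset of a complex module is algebraic (Zariski closed) if it is the common zero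
set of a family of polynomial functions. -/
def IsAlgSet {W : Type*} [AddCommGroup W] [Module ℂ W] (X : Set W) : Prop :=
  ∃ S : Set (W → ℂ), S ⊆ (PolyFun W : Set (W → ℂ)) ∧ X = {x | ∀ f ∈ S, f x = 0}

/-- Zariski closure. -/
def zcl {W : Type*} [AddCommGroup W] [Module ℂ W] (A : Set W) : Set W :=
  ⋂₀ {Y | IsAlgSet Y ∧ A ⊆ Y}

/-- Irreducible algebraic set. -/
def IsIrrAlg {W : Type*} [AddCommGroup W] [Module ℂ W] (X : Set W) : Prop :=
  X.Nonempty ∧ IsAlgSet X ∧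
    ∀ Y Z : Set W, IsAlgSet Y → IsAlgSet Z → X ⊆ Y ∪ Z → X ⊆ Y ∨ X ⊆ Z

/-- Dimension of an (affine) algebraic set: the supremum of the lengths of strict chains
of irreducible algebraic subsets contained in it. -/
def adim {W : Type*} [AddCommGroup W] [Module ℂ W] (X : Set W) : ℕ∞ :=
  sSup {d : ℕ∞ | ∃ n : ℕ, d = (n : ℕ∞) ∧
    ∃ c : Fin (n + 1) → Set W, StrictMono c ∧ ∀ i, IsIrrAlg (c i) ∧ c i ⊆ X}

/-- Projective dimension of a cone: one less than the dimension of the affine cone. -/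
def pdim {W : Type*} [AddCommGroup W] [Module ℂ W] (X : Set W) : ℕ∞ := adim X - 1

/-- A cone in a complex module (the affine cone of a projective set). -/
def IsCone {W : Type*} [AddCommGroup W] [Module ℂ W] (X : Set W) : Prop :=
  (0 : W) ∈ X ∧ ∀ (c : ℂ) (x : W), x ∈ X → c • x ∈ X

/-- The affine cone of an integral projective variety: an irreducible algebraic cone,
different from the origin alone. -/
def IsProjVar {W : Type*} [AddCommGroup W] [Module ℂ W] (X : Set W) : Prop :=
  IsAlgSet X ∧ IsCone X ∧ IsIrrAlg X ∧ X ≠ {0}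

/-- Non-degenerate: the cone spans the ambient space. -/
def Nondeg {W : Type*} [AddCommGroup W] [Module ℂ W] (X : Set W) : Prop :=
  Submodule.span ℂ X = ⊤

/-- The projective set is a cone over some vertex: there is a point `v` (vertex) of the
variety such that the variety is a union of lines through the vertex. -/
def IsConeVar {W : Type*} [AddCommGroup W] [Module ℂ W] (X : Set W) : Prop :=
  ∃ v ∈ X, v ≠ 0 ∧ ∀ x ∈ X, ∀ a b : ℂ, a • v + b • x ∈ X

/-- Affine cone of the `k`-th secant variety `S_k(X)`: the Zariski closure of the union
of the linear spans of `k+1` points of `X`. -/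
def Sec {W : Type*} [AddCommGroup W] [Module ℂ W] (X : Set W) (k : ℕ) : Set W :=
  zcl (⋃ p ∈ {p : Fin (k + 1) → W | ∀ i, p i ∈ X},
    (Submodule.span ℂ (Set.range p) : Set W))

/-- Plücker points of the spans of `(k+1)`-tuples of points of `X`: the raw affine cone
over the image of the span map `Φ : X^{k+1} ⇢ G(k,r)` in Plücker coordinates. -/
def GkConePre {W : Type*} [AddCommGroup W] [Module ℂ W] (X : Set W) (k : ℕ) :
    Set (ExteriorAlgebra ℂ W) :=
  {w | ∃ p : Fin (k + 1) → W, (∀ i, p i ∈ X) ∧ w = ExteriorAlgebra.ιMulti ℂ (k + 1) p}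

/-- Affine cone over `G_k(X)` (in Plücker coordinates): Zariski closure of the cone over
the image of the span map. -/
def GkCone {W : Type*} [AddCommGroup W] [Module ℂ W] (X : Set W) (k : ℕ) :
    Set (ExteriorAlgebra ℂ W) :=
  zcl (GkConePre X k)

/-- `G_k(X)` as a set of `(k+1)`-dimensional subspaces (projective `k`-planes): those
whose Plücker point lies in the closure of the image of the span map. -/
def Gk {W : Type*} [AddCommGroup W] [Module ℂ W] (X : Set W) (k : ℕ) :
    Set (Submodule ℂ W) :=
  {U | Module.finrank ℂ U = k + 1 ∧
    ∀ p : Fin (k + 1) → W, (∀ i, p i ∈ U) →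
      ExteriorAlgebra.ιMulti ℂ (k + 1) p ∈ GkCone X k}

/-- Raw cone of Plücker points of `h`-planes contained in some `(k+1)`-secant `k`-plane. -/
def GhkConePre {W : Type*} [AddCommGroup W] [Module ℂ W] (X : Set W) (h k : ℕ) :
    Set (ExteriorAlgebra ℂ W) :=
  {w | ∃ (p : Fin (k + 1) → W) (q : Fin (h + 1) → W), (∀ i, p i ∈ X) ∧
    (∀ j, q j ∈ Submodule.span ℂ (Set.range p)) ∧
    w = ExteriorAlgebra.ιMulti ℂ (h + 1) q}

/-- Affine cone over `G_{h,k}(X)` in Plücker coordinates. -/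
def GhkCone {W : Type*} [AddCommGroup W] [Module ℂ W] (X : Set W) (h k : ℕ) :
    Set (ExteriorAlgebra ℂ W) :=
  zcl (GhkConePre X h k)

open TensorProduct

theorem Derivation.exists_extend_of_formallyEtale {S T : Type*} [CommRing S] [CommRing T]
    [Algebra ℂ S] [Algebra ℂ T] [Algebra S T] [IsScalarTower ℂ S T] [Algebra.FormallyEtale S T]
    (d : Derivation ℂ S T) : ∃ D : Derivation ℂ T T, ∀ s, D (algebraMap S T s) = d s := by
  let e := KaehlerDifferential.tensorKaehlerEquivOfFormallyEtale ℂ S T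
  refine ⟨((d.liftKaehlerDifferential.liftBaseChange T).comp
    e.symm.toLinearMap).compDer (KaehlerDifferential.D ℂ T), fun s => ?_⟩
  have h := KaehlerDifferential.tensorKaehlerEquivOfFormallyEtale_symm_D_algebraMap ℂ S T s
  simp [e, h]

theorem charZero_of_complexAlgebra (K : Type*) [Field K] [Algebra ℂ K] : CharZero K :=
  charZero_of_injective_algebraMap (algebraMap ℂ K).injective

theorem exists_derivation_of_isTranscendenceBasis {K ι : Type*} [Field K] [Algebra ℂ K]
    {b : ι → K} (hb : IsTranscendenceBasis ℂ b) (c : ι → K) :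
    ∃ D : Derivation ℂ K K, ∀ i, D (b i) = c i := by
  have := charZero_of_complexAlgebra K
  let := (MvPolynomial.aeval (R := ℂ) b).toAlgebra
  have : IsScalarTower ℂ (MvPolynomial ι ℂ) K := .of_algHom (MvPolynomial.aeval b)
  have hinj : Function.Injective (algebraMap (MvPolynomial ι ℂ) K) := hb.1
  have : FaithfulSMul (MvPolynomial ι ℂ) K := (faithfulSMul_iff_algebraMap_injective _ _).2 hinj
  have : Algebra.IsAlgebraic (MvPolynomial ι ℂ) K := by
    have h := hb.isAlgebraic
    refine (Algebra.isAlgebraic_ringHom_iff_of_comp_eq hb.1.aevalEquiv.toRingEquiv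
      (RingEquiv.refl K) ?_).1 h
    ext x <;> simp [RingHom.algebraMap_toAlgebra]
  let := FractionRing.liftAlgebra (MvPolynomial ι ℂ) K
  have : IsScalarTower (MvPolynomial ι ℂ) (FractionRing (MvPolynomial ι ℂ)) K :=
    FractionRing.isScalarTower_liftAlgebra _ _
  have : Algebra.IsAlgebraic (FractionRing (MvPolynomial ι ℂ)) K :=
    (IsFractionRing.comap_isAlgebraic_iff (A := MvPolynomial ι ℂ)).1 inferInstance
  have : Algebra.FormallyEtale (FractionRing (MvPolynomial ι ℂ)) K :=
    Algebra.FormallyEtale.of_isSeparable _ _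
  have : Algebra.FormallyEtale (MvPolynomial ι ℂ) (FractionRing (MvPolynomial ι ℂ)) :=
    .of_isLocalization (nonZeroDivisors _)
  have : Algebra.FormallyEtale (MvPolynomial ι ℂ) K :=
    .comp _ (FractionRing (MvPolynomial ι ℂ)) _
  obtain ⟨D, hD⟩ := Derivation.exists_extend_of_formallyEtale
    (MvPolynomial.mkDerivation ℂ c : Derivation ℂ (MvPolynomial ι ℂ) K)
  refine ⟨D, fun i => ?_⟩
  have := hD (MvPolynomial.X i)
  rw [MvPolynomial.mkDerivation_X] at this
  rw [← this]
  congr 1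
  exact (MvPolynomial.aeval_X b i).symm

theorem exists_derivation_of_algebraicIndependent {K ι : Type*} [Field K] [Algebra ℂ K]
    {b : ι → K} (hb : AlgebraicIndependent ℂ b) (c : ι → K) :
    ∃ D : Derivation ℂ K K, ∀ i, D (b i) = c i := by
  obtain ⟨t, ht, htb⟩ := exists_isTranscendenceBasis_superset hb.coe_range
  have hbi := hb.injective
  obtain ⟨D, hD⟩ := exists_derivation_of_isTranscendenceBasis htb
    (fun x => Function.extend b c 0 x)
  exact ⟨D, fun i => by simpa [hbi.extend_apply] using hD ⟨b i, ht ⟨i, rfl⟩⟩⟩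

/-- The field of constants of a derivation. -/
def Derivation.constants {K : Type*} [Field K] [Algebra ℂ K] (D : Derivation ℂ K K) :
    IntermediateField ℂ K where
  carrier := {x | D x = 0}
  mul_mem' {a b} ha hb := by simp_all
  add_mem' {a b} ha hb := by simp_all
  algebraMap_mem' r := by simp
  inv_mem' a ha := by simp_all [Derivation.leibniz_inv]

theorem Derivation.mem_constants {K : Type*} [Field K] [Algebra ℂ K] (D : Derivation ℂ K K)
    (x : K) : x ∈ D.constants ↔ D x = 0 := Iff.rfl

theorem Derivation.eq_zero_of_isIntegral_constants {K : Type*} [Field K] [Algebra ℂ K]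
    (D : Derivation ℂ K K) {x : K} (hx : IsIntegral D.constants x) : D x = 0 := by
  have := charZero_of_complexAlgebra K
  let D' : Derivation D.constants K K := Derivation.mk'
    { toFun := D
      map_add' := by simp
      map_smul' := by
        rintro ⟨c, hc⟩ y
        rw [Derivation.mem_constants] at hc
        simp [Algebra.smul_def, IntermediateField.algebraMap_apply, hc] } (by simp)
  have h := D'.map_aeval (minpoly D.constants x) x
  have hs := (minpoly.irreducible hx).separable.aeval_derivative_ne_zero (minpoly.aeval _ x)
  rw [minpoly.aeval, map_zero, eq_comm, smul_eq_zero] at h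
  exact h.resolve_left hs

/-- The linear map sending a derivation to its values on a family of elements. -/
def derivationValues {K ι : Type*} [Field K] [Algebra ℂ K] (a : ι → K) :
    Derivation ℂ K K →ₗ[K] (ι → K) where
  toFun D i := D (a i)
  map_add' _ _ := rfl
  map_smul' _ _ := rfl

theorem finrank_range_derivationValues {K ι : Type*} [Field K] [Algebra ℂ K] (a : ι → K)
    {s : ℕ} (g : MvPolynomial (Fin s) ℂ →ₐ[ℂ] K) (hg : Function.Injective g)
    (hga : ∀ p, g p ∈ Algebra.adjoin ℂ (Set.range a))
    (h_int : ∀ i, g.toRingHom.IsIntegralElem (a i)) :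
    Module.finrank K (LinearMap.range (derivationValues a)) = s := by
  set b : Fin s → K := fun j => g (MvPolynomial.X j)
  have hgb : g = MvPolynomial.aeval b := by ext; simp [b]
  have hb : AlgebraicIndependent ℂ b := by
    rw [algebraicIndependent_iff_injective_aeval, ← hgb]; exact hg
  have hker : LinearMap.ker (derivationValues a) = LinearMap.ker (derivationValues b) := by
    ext D
    simp only [LinearMap.mem_ker, funext_iff]
    change (∀ i, D (a i) = 0) ↔ (∀ i, D (b i) = 0)
    constructor
    · intro h j
      have h1 : Algebra.adjoin ℂ (Set.range a) ≤ D.constants.toSubalgebra :=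
        Algebra.adjoin_le (by rintro _ ⟨i, rfl⟩; exact h i)
      exact h1 (hga _)
    · intro h i
      apply D.eq_zero_of_isIntegral_constants
      have h1 : ∀ p, g p ∈ D.constants := by
        intro p
        have : g p ∈ Algebra.adjoin ℂ (Set.range b) := by
          rw [Algebra.adjoin_range_eq_range_aeval, ← hgb]; exact ⟨p, rfl⟩
        exact (Algebra.adjoin_le (S := D.constants.toSubalgebra)
          (by rintro _ ⟨i, rfl⟩; exact h i)) this
      obtain ⟨p, hp, hpa⟩ := h_int i
      let g' : MvPolynomial (Fin s) ℂ →+* D.constants := g.toRingHom.codRestrict _ h1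
      refine ⟨p.map g', hp.map _, ?_⟩
      rw [Polynomial.eval₂_map]
      exact hpa
  have hsurj : LinearMap.range (derivationValues b) = ⊤ := by
    rw [LinearMap.range_eq_top]
    intro c
    obtain ⟨D, hD⟩ := exists_derivation_of_algebraicIndependent hb c
    exact ⟨D, funext hD⟩
  have e := (derivationValues a).quotKerEquivRange.symm.trans
    ((Submodule.quotEquivOfEq _ _ hker).trans (derivationValues b).quotKerEquivRange)
  rw [e.finrank_eq, hsurj, finrank_top, Module.finrank_fin_fun]

theorem ringKrullDim_eq_of_isIntegral_injective {R S : Type*} [CommRing R] [CommRing S]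
    [Algebra R S] [Algebra.IsIntegral R S] [IsDomain S]
    (hinj : Function.Injective (algebraMap R S)) : ringKrullDim S = ringKrullDim R := by
  apply le_antisymm
  · refine Order.krullDim_le_of_strictMono (PrimeSpectrum.comap (algebraMap R S)) ?_
    intro I J hIJ
    exact Ideal.IsIntegral.comap_lt_comap (I := I.asIdeal) (J := J.asIdeal) hIJ
  · refine iSup_le fun l => ?_
    obtain ⟨Q, -, hQ, hQl⟩ := Ideal.exists_ideal_over_prime_of_isIntegral
      (l.head.asIdeal) (⊥ : Ideal S) (by
        intro x hx
        have : x = 0 := hinj (by simpa using hx)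
        simp [this])
    have : Q.LiesOver l.head.asIdeal := ⟨hQl.symm⟩
    obtain ⟨L, hL, -⟩ := Ideal.exists_ltSeries_of_hasGoingUp l Q
    rw [← hL]
    exact le_iSup (fun p : LTSeries (PrimeSpectrum S) => (p.length : WithBot ℕ∞)) L

section

variable {W ι : Type*} [AddCommGroup W] [Module ℂ W] [Fintype ι] (e : Module.Basis ι ℂ W)

theorem mem_polyFun_iff (f : W → ℂ) :
    f ∈ PolyFun W ↔ ∃ p : MvPolynomial ι ℂ, ∀ w, f w = MvPolynomial.eval (e.equivFun w) p := by
  let φ : MvPolynomial ι ℂ →ₐ[ℂ] (W → ℂ) := MvPolynomial.aeval (fun i w => e.equivFun w i)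
  have hφ : ∀ p w, φ p w = MvPolynomial.eval (e.equivFun w) p := by
    intro p w
    have : ((Pi.evalAlgHom ℂ (fun _ : W => ℂ) w).comp φ) =
        MvPolynomial.aeval (e.equivFun w) := by ext i; simp [φ]
    simpa using congrArg (fun h => h p) this
  have h1 : PolyFun W = φ.range := by
    apply le_antisymm
    · refine Algebra.adjoin_le fun f hf => ?_
      refine ⟨∑ i, MvPolynomial.C (f (e i)) * MvPolynomial.X i, funext fun w => ?_⟩
      change φ _ w = _
      rw [hφ]
      have h2 : f w = hf.mk' f w := rfl
      conv_rhs => rw [h2, ← e.sum_equivFun w]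
      simp [mul_comm, -Module.Basis.sum_repr, map_sum, IsLinearMap.mk'_apply]
    · rw [← Algebra.adjoin_range_eq_range_aeval]
      refine Algebra.adjoin_mono ?_
      rintro _ ⟨i, rfl⟩
      exact ⟨fun x y => by simp, fun c x => by simp⟩
  rw [h1]
  constructor
  · rintro ⟨p, rfl⟩
    exact ⟨p, hφ p⟩
  · rintro ⟨p, hp⟩
    exact ⟨p, funext fun w => (hφ p w).trans (hp w).symm⟩

/-- The zero set in `W` of an ideal of polynomials in the coordinates of a basis. -/
def zeroSet (I : Ideal (MvPolynomial ι ℂ)) : Set W :=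
  {w | ∀ p ∈ I, MvPolynomial.eval (e.equivFun w) p = 0}

/-- The ideal of polynomials in the coordinates of a basis that vanish on a set. -/
def idealOf (Y : Set W) : Ideal (MvPolynomial ι ℂ) where
  carrier := {p | ∀ w ∈ Y, MvPolynomial.eval (e.equivFun w) p = 0}
  add_mem' := by intro a b ha hb w hw; simp [-Module.Basis.equivFun_apply, ha w hw, hb w hw]
  zero_mem' := by simp
  smul_mem' := by intro c a ha w hw; simp [-Module.Basis.equivFun_apply, ha w hw]

variable {e}

theorem mem_idealOf {Y : Set W} {p : MvPolynomial ι ℂ} :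
    p ∈ idealOf e Y ↔ ∀ w ∈ Y, MvPolynomial.eval (e.equivFun w) p = 0 := Iff.rfl

variable (e)

theorem isAlgSet_zeroSet (I : Ideal (MvPolynomial ι ℂ)) : IsAlgSet (zeroSet e I) := by
  refine ⟨(fun p w => MvPolynomial.eval (e.equivFun w) p) '' (I : Set (MvPolynomial ι ℂ)),
    ?_, ?_⟩
  · rintro _ ⟨p, -, rfl⟩
    exact (mem_polyFun_iff e _).2 ⟨p, fun _ => rfl⟩
  · ext w; simp [zeroSet]

theorem IsAlgSet.zeroSet_idealOf {Y : Set W} (hY : IsAlgSet Y) :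
    zeroSet e (idealOf e Y) = Y := by
  apply Set.Subset.antisymm
  · obtain ⟨S, hS, rfl⟩ := hY
    intro w hw f hf
    obtain ⟨p, hp⟩ := (mem_polyFun_iff e f).1 (hS hf)
    rw [hp]
    exact hw p fun v hv => by rw [← hp]; exact hv f hf
  · exact fun w hw p hp => hp w hw

theorem idealOf_zeroSet (Q : Ideal (MvPolynomial ι ℂ)) [Q.IsPrime] :
    idealOf e (zeroSet e Q) = Q := by
  conv_rhs => rw [← MvPolynomial.IsPrime.vanishingIdeal_zeroLocus (K := ℂ) Q]
  ext p
  rw [mem_idealOf, MvPolynomial.mem_vanishingIdeal_iff]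
  constructor
  · intro h x hx
    have := h (e.equivFun.symm x) (by
      intro q hq
      rw [LinearEquiv.apply_symm_apply]; exact hx q hq)
    rwa [LinearEquiv.apply_symm_apply] at this
  · intro h w hw
    simpa using h (e.equivFun w) (by
      intro q hq
      simpa using hw q hq)

theorem zcl_eq_zeroSet (A : Set W) : zcl A = zeroSet e (idealOf e A) := by
  apply Set.Subset.antisymm
  · exact Set.sInter_subset_of_mem ⟨isAlgSet_zeroSet e _, fun w hw p hp => hp w hw⟩
  · rintro w hw Y ⟨hY, hAY⟩
    rw [← hY.zeroSet_idealOf e]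
    exact fun p hp => hw p fun v hv => hp v (hAY hv)

theorem IsIrrAlg.isPrime_idealOf {Y : Set W} (hY : IsIrrAlg Y) : (idealOf e Y).IsPrime := by
  obtain ⟨⟨w, hw⟩, hYa, h⟩ := hY
  refine ⟨fun h1 => ?_, fun {p q} hpq => ?_⟩
  · have := (Ideal.eq_top_iff_one _).1 h1 w hw
    simp at this
  · have key : ∀ p, Y ⊆ zeroSet e (Ideal.span {p}) → p ∈ idealOf e Y := fun p hp v hv =>
      hp hv p (Ideal.mem_span_singleton_self p)
    refine (h _ _ (isAlgSet_zeroSet e (Ideal.span {p})) (isAlgSet_zeroSet e (Ideal.span {q}))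
      ?_).imp (key p) (key q)
    intro v hv
    have := hpq v hv
    rw [map_mul, mul_eq_zero] at this
    refine this.imp ?_ ?_ <;>
    · intro h0 r hr
      obtain ⟨s, rfl⟩ := Ideal.mem_span_singleton'.1 hr
      simp [-Module.Basis.equivFun_apply, h0]

theorem isIrrAlg_zeroSet (Q : Ideal (MvPolynomial ι ℂ)) [hQ : Q.IsPrime] :
    IsIrrAlg (zeroSet e Q) := by
  refine ⟨?_, isAlgSet_zeroSet e Q, fun Y Z hY hZ hYZ => ?_⟩
  · by_contra h
    rw [Set.not_nonempty_iff_eq_empty] at h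
    apply hQ.ne_top
    rw [← idealOf_zeroSet e Q, h, Ideal.eq_top_iff_one]
    exact fun w hw => hw.elim
  · by_contra! hcon
    obtain ⟨h1, h2⟩ := hcon
    have aux : ∀ Y, IsAlgSet Y → ¬ zeroSet e Q ⊆ Y → ∃ p ∈ idealOf e Y, p ∉ Q := by
      intro Y hY h
      by_contra! hc
      apply h
      rw [← hY.zeroSet_idealOf e]
      exact fun w hw p hp => hw p (hc p hp)
    obtain ⟨p, hp, hpQ⟩ := aux Y hY h1
    obtain ⟨q, hq, hqQ⟩ := aux Z hZ h2
    have : p * q ∈ Q := by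
      rw [← idealOf_zeroSet e Q]
      intro w hw
      rcases hYZ hw with h | h
      · simp [-Module.Basis.equivFun_apply, hp w h]
      · simp [-Module.Basis.equivFun_apply, hq w h]
    exact (hQ.mem_or_mem this).elim hpQ hqQ

theorem idealOf_strictAnti {Y Z : Set W} (hY : IsAlgSet Y) (h : Y < Z) (hZ : IsAlgSet Z) :
    idealOf e Z < idealOf e Y := by
  refine lt_of_le_of_ne (fun p hp w hw => hp w (h.le hw)) fun h1 => h.ne ?_
  rw [← hY.zeroSet_idealOf e, ← hZ.zeroSet_idealOf e, h1]

theorem zeroSet_strictAnti {P Q : Ideal (MvPolynomial ι ℂ)} [P.IsPrime] [Q.IsPrime]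
    (h : P < Q) : zeroSet e Q < zeroSet e P := by
  refine lt_of_le_of_ne (fun w hw p hp => hw p (h.le hp)) fun h1 => h.ne ?_
  rw [← idealOf_zeroSet e P, ← idealOf_zeroSet e Q, h1]

theorem adim_zeroSet (J : Ideal (MvPolynomial ι ℂ)) [J.IsPrime] {s : ℕ}
    (hs : ringKrullDim (MvPolynomial ι ℂ ⧸ J) = s) : adim (zeroSet e J) = s := by
  have key : ∀ n : ℕ, (∃ c : Fin (n + 1) → Set W, StrictMono c ∧
      ∀ i, IsIrrAlg (c i) ∧ c i ⊆ zeroSet e J) ↔ n ≤ s := by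
    intro n
    have h1 : n ≤ s ↔ (n : WithBot ℕ∞) ≤ ringKrullDim (MvPolynomial ι ℂ ⧸ J) := by
      rw [hs]; norm_cast
    rw [h1, ringKrullDim, Order.le_krullDim_iff]
    constructor
    · rintro ⟨c, hc, hci⟩
      have hJ : ∀ i, J ≤ idealOf e (c i) := fun i p hp w hw => (hci i).2 hw p hp
      have hp : ∀ i, (idealOf e (c i)).IsPrime := fun i => (hci i).1.isPrime_idealOf e
      have hcm : ∀ i, ((idealOf e (c i)).map (Ideal.Quotient.mk J)).comap
          (Ideal.Quotient.mk J) = idealOf e (c i) := fun i => by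
        rw [Ideal.comap_map_of_surjective _ Ideal.Quotient.mk_surjective,
          ← RingHom.ker_eq_comap_bot, Ideal.mk_ker, sup_eq_left]
        exact hJ i
      refine ⟨LTSeries.mk n (fun i => ⟨(idealOf e (c i.rev)).map (Ideal.Quotient.mk J),
        Ideal.map_isPrime_of_surjective Ideal.Quotient.mk_surjective
          (by rw [Ideal.mk_ker]; exact hJ _)⟩) ?_, rfl⟩
      intro i j hij
      change (idealOf e (c i.rev)).map (Ideal.Quotient.mk J) <
        (idealOf e (c j.rev)).map (Ideal.Quotient.mk J)
      have h2 := idealOf_strictAnti e (hci j.rev).1.2.1 (hc (Fin.rev_lt_rev.2 hij))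
        (hci i.rev).1.2.1
      refine lt_of_le_of_ne (Ideal.map_mono h2.le) fun h3 => h2.ne ?_
      rw [← hcm, ← hcm j.rev, h3]
    · rintro ⟨L, rfl⟩
      refine ⟨fun i => zeroSet e ((L i.rev).asIdeal.comap (Ideal.Quotient.mk J)), ?_,
        fun i => ⟨isIrrAlg_zeroSet e _, ?_⟩⟩
      · intro i j hij
        refine zeroSet_strictAnti e ?_
        have h2 : (L j.rev).asIdeal < (L i.rev).asIdeal := L.strictMono (Fin.rev_lt_rev.2 hij)
        refine lt_of_le_of_ne (Ideal.comap_mono h2.le) fun h3 => h2.ne ?_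
        exact Ideal.comap_injective_of_surjective _ Ideal.Quotient.mk_surjective h3
      · intro w hw p hp
        refine hw p ?_
        rw [Ideal.mem_comap, Ideal.Quotient.eq_zero_iff_mem.2 hp]
        exact zero_mem _
  apply le_antisymm
  · refine sSup_le ?_
    rintro _ ⟨n, rfl, h⟩
    exact_mod_cast (key n).1 h
  · exact le_sSup ⟨s, rfl, (key s).2 le_rfl⟩

theorem adim_mono {Y Z : Set W} (h : Y ⊆ Z) : adim Y ≤ adim Z := by
  refine sSup_le_sSup ?_
  rintro d ⟨n, rfl, c, hc, hci⟩
  exact ⟨n, rfl, c, hc, fun i => ⟨(hci i).1, (hci i).2.trans h⟩⟩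

theorem zcl_mono {A B : Set W} (h : A ⊆ B) : zcl A ⊆ zcl B :=
  Set.sInter_subset_sInter fun _ hY => ⟨hY.1, h.trans hY.2⟩

theorem adim_zcl_eq_finrank {K : Type*} [Field K] [Algebra ℂ K] (a : ι → K) (S : Set W)
    (hker : ∀ f : MvPolynomial ι ℂ,
      MvPolynomial.aeval a f = 0 ↔ ∀ w ∈ S, MvPolynomial.eval (e.equivFun w) f = 0) :
    adim (zcl S) = Module.finrank K (LinearMap.range (derivationValues a)) := by
  set φ : MvPolynomial ι ℂ →ₐ[ℂ] K := MvPolynomial.aeval a with hφ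
  have hJ : idealOf e S = RingHom.ker φ := by
    ext f; rw [mem_idealOf, RingHom.mem_ker, hker]
  rw [zcl_eq_zeroSet e, hJ]
  have : (RingHom.ker φ).IsPrime := RingHom.ker_isPrime _
  let ψ : (MvPolynomial ι ℂ ⧸ RingHom.ker φ) →ₐ[ℂ] K := Ideal.kerLiftAlg φ
  have hψ : Function.Injective ψ := Ideal.kerLiftAlg_injective φ
  obtain ⟨s, g, hg, h_int⟩ := exists_integral_inj_algHom_of_fg ℂ (MvPolynomial ι ℂ ⧸ RingHom.ker φ)
  rw [finrank_range_derivationValues a (ψ.comp g) (hψ.comp hg)]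
  · apply adim_zeroSet
    algebraize [g.toRingHom]
    have : Algebra.IsIntegral (MvPolynomial (Fin s) ℂ) (MvPolynomial ι ℂ ⧸ RingHom.ker φ) := ⟨h_int⟩
    rw [ringKrullDim_eq_of_isIntegral_injective (R := MvPolynomial (Fin s) ℂ) hg,
      MvPolynomial.ringKrullDim_of_isNoetherianRing, ringKrullDim_eq_zero_of_field]
    simp
  · intro p
    rw [Algebra.adjoin_range_eq_range_aeval]
    obtain ⟨q, hq⟩ := Ideal.Quotient.mk_surjective (g p)
    refine ⟨q, ?_⟩
    change φ q = ψ (g p)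
    rw [← hq]
    exact (Ideal.kerLiftAlg_mk φ q).symm
  · intro i
    have h1 : a i = ψ (Ideal.Quotient.mk _ (MvPolynomial.X i)) := by
      change _ = Ideal.kerLiftAlg φ _
      rw [Ideal.kerLiftAlg_mk]; simp [hφ]
    obtain ⟨p, hp, hp0⟩ := h_int (Ideal.Quotient.mk _ (MvPolynomial.X i))
    refine ⟨p, hp, ?_⟩
    rw [h1]
    have := Polynomial.hom_eval₂ p g.toRingHom ψ.toRingHom
      (Ideal.Quotient.mk _ (MvPolynomial.X i))
    refine Eq.trans this.symm ?_
    rw [show Polynomial.eval₂ g.toRingHom _ p = 0 from hp0, map_zero]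

end

/-- A family of ring homomorphisms that detects zero. -/
def JointlyInjective {κ P : Type*} [CommRing P] [Algebra ℂ P] (E : κ → P →ₐ[ℂ] ℂ) : Prop :=
  ∀ p, (∀ k, E k p = 0) → p = 0

/-- Specialization of the left factor of a tensor product at a point. -/
def evalLeft {P : Type*} (Q : Type*) [CommRing P] [Algebra ℂ P] [CommRing Q] [Algebra ℂ Q]
    (ε : P →ₐ[ℂ] ℂ) : P ⊗[ℂ] Q →ₐ[ℂ] Q :=
  Algebra.TensorProduct.productMap ((Algebra.ofId ℂ Q).comp ε) (AlgHom.id ℂ Q)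

theorem exists_coeff_of_tensor_ne_zero {P Q : Type*} [CommRing P] [Algebra ℂ P] [CommRing Q]
    [Algebra ℂ Q] {t : P ⊗[ℂ] Q} (ht : t ≠ 0) :
    ∃ p : P, p ≠ 0 ∧ ∀ ε : P →ₐ[ℂ] ℂ, ε p ≠ 0 → evalLeft Q ε t ≠ 0 := by
  classical
  let b := Module.Basis.ofVectorSpace ℂ Q
  have h1 : equivFinsuppOfBasisRight b t ≠ 0 := by simpa using ht
  obtain ⟨i, hi⟩ := Finsupp.ne_iff.1 h1
  refine ⟨_, hi, fun ε hε h0 => hε ?_⟩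
  have key : ∀ t : P ⊗[ℂ] Q,
      b.repr (evalLeft Q ε t) i = ε (equivFinsuppOfBasisRight b t i) := by
    intro t
    induction t with
    | zero => simp
    | add x y hx hy => simp [hx, hy]
    | tmul p q =>
      have : evalLeft Q ε (p ⊗ₜ q) = ε p • q := by
        simp [evalLeft, Algebra.ofId_apply, Algebra.smul_def]
      rw [this]
      simp [mul_comm]
  rw [← key, h0]
  simp

theorem JointlyInjective.productMap {κ κ' P Q : Type*} [CommRing P] [Algebra ℂ P] [CommRing Q]
    [Algebra ℂ Q] {E : κ → P →ₐ[ℂ] ℂ} {F : κ' → Q →ₐ[ℂ] ℂ} (hE : JointlyInjective E)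
    (hF : JointlyInjective F) :
    JointlyInjective fun k : κ × κ' => Algebra.TensorProduct.productMap (E k.1) (F k.2) := by
  intro t ht
  by_contra h
  obtain ⟨p, hp, hpt⟩ := exists_coeff_of_tensor_ne_zero h
  apply hp
  refine hE p fun k => ?_
  by_contra hk
  refine hpt _ hk (hF _ fun k' => ?_)
  rw [← ht (k, k')]
  have : (F k').comp (evalLeft Q (E k)) = Algebra.TensorProduct.productMap (E k) (F k') := by
    ext <;> simp [evalLeft, Algebra.ofId_apply]
  exact congrArg (fun h => h t) this

theorem JointlyInjective.isDomain_tensorProduct {κ P Q : Type*} [CommRing P] [Algebra ℂ P]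
    [CommRing Q] [Algebra ℂ Q] [IsDomain P] [IsDomain Q] {E : κ → P →ₐ[ℂ] ℂ}
    (hE : JointlyInjective E) : IsDomain (P ⊗[ℂ] Q) := by
  have : NoZeroDivisors (P ⊗[ℂ] Q) := by
    refine ⟨fun {s t} hst => ?_⟩
    by_contra! h
    obtain ⟨p, hp, hps⟩ := exists_coeff_of_tensor_ne_zero h.1
    obtain ⟨q, hq, hqt⟩ := exists_coeff_of_tensor_ne_zero h.2
    apply mul_ne_zero hp hq
    refine hE _ fun k => ?_
    by_contra hk
    rw [map_mul] at hk
    have h1 := mul_ne_zero (hps _ (left_ne_zero_of_mul hk)) (hqt _ (right_ne_zero_of_mul hk))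
    rw [← map_mul, hst, map_zero] at h1
    exact h1 rfl
  have : Nontrivial (P ⊗[ℂ] Q) :=
    Algebra.TensorProduct.nontrivial_of_algebraMap_injective_of_isDomain
      (ha := (algebraMap ℂ P).injective) (hb := (algebraMap ℂ Q).injective)
  exact NoZeroDivisors.to_isDomain _

theorem Derivation.map_aeval_eq_sum {σ A M : Type*} [Fintype σ] [CommRing A] [Algebra ℂ A]
    [AddCommGroup M] [Module A M] [Module ℂ M] [IsScalarTower ℂ A M] (D : Derivation ℂ A M)
    (ξ : σ → A) (f : MvPolynomial σ ℂ) :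
    D (MvPolynomial.aeval ξ f) =
      ∑ j, MvPolynomial.aeval ξ (MvPolynomial.pderiv j f) • D (ξ j) := by
  classical
  induction f using MvPolynomial.induction_on with
  | C c => simp
  | add p q hp hq => simp [hp, hq, add_smul, Finset.sum_add_distrib]
  | mul_X p i hp =>
    simp [MvPolynomial.pderiv_X, hp, add_smul, Finset.sum_add_distrib, Finset.smul_sum,
      Pi.single_apply, smul_smul, mul_comm, ite_smul, add_comm, apply_ite]

/-- The extension of scalars of the tangent space at a point with values in an algebra. -/
def tangent {σ K : Type*} [Fintype σ] [CommRing K] [Algebra ℂ K] (I : Ideal (MvPolynomial σ ℂ))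
    (ξ : σ → K) : Submodule K (σ → K) where
  carrier := {v | ∀ f ∈ I, ∑ j, MvPolynomial.aeval ξ (MvPolynomial.pderiv j f) * v j = 0}
  add_mem' := by
    intro v w hv hw f hf
    simp [mul_add, Finset.sum_add_distrib, hv f hf, hw f hf]
  zero_mem' := by simp
  smul_mem' := by
    intro c v hv f hf
    simp only [Pi.smul_apply, smul_eq_mul]
    rw [← mul_zero c, ← hv f hf, Finset.mul_sum]
    exact Finset.sum_congr rfl fun j _ => by ring

theorem mem_tangent {σ K : Type*} [Fintype σ] [CommRing K] [Algebra ℂ K]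
    {I : Ideal (MvPolynomial σ ℂ)} {ξ v : σ → K} : v ∈ tangent I ξ ↔
      ∀ f ∈ I, ∑ j, MvPolynomial.aeval ξ (MvPolynomial.pderiv j f) * v j = 0 := Iff.rfl

theorem derivation_mem_tangent {σ K : Type*} [Fintype σ] [CommRing K] [Algebra ℂ K]
    {I : Ideal (MvPolynomial σ ℂ)} {ξ : σ → K} (hξ : ∀ f ∈ I, MvPolynomial.aeval ξ f = 0)
    (D : Derivation ℂ K K) : (fun j => D (ξ j)) ∈ tangent I ξ := by
  intro f hf
  have := D.map_aeval_eq_sum ξ f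
  rw [hξ f hf, map_zero] at this
  simpa using this.symm

theorem aeval_inl_add_inr {σ K : Type*} [Fintype σ] [CommRing K] [Algebra ℂ K] (ξ v : σ → K)
    (f : MvPolynomial σ ℂ) :
    MvPolynomial.aeval
      (fun j => (TrivSqZeroExt.inl (ξ j) + TrivSqZeroExt.inr (v j) : TrivSqZeroExt K K)) f =
    TrivSqZeroExt.inl (MvPolynomial.aeval ξ f) + TrivSqZeroExt.inr
      (∑ j, MvPolynomial.aeval ξ (MvPolynomial.pderiv j f) * v j) := by
  classical
  induction f using MvPolynomial.induction_on with
  | C c =>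
    ext <;> simp [TrivSqZeroExt.algebraMap_eq_inl']
  | add p q hp hq =>
    rw [map_add, hp, hq]
    ext <;> simp [add_mul, Finset.sum_add_distrib]
  | mul_X p i hp =>
    rw [map_mul, hp]
    ext
    · simp
    · simp [MvPolynomial.pderiv_X, add_mul, Finset.sum_add_distrib, Pi.single_apply, apply_ite,
        ite_mul]
      rw [Finset.sum_mul]
      exact Finset.sum_congr rfl fun j _ => by ring

theorem exists_derivation_of_algHom_dual {A K : Type*} [CommRing A] [IsDomain A] [Algebra ℂ A]
    [Field K] [Algebra ℂ K] [Algebra A K] [IsScalarTower ℂ A K] [IsFractionRing A K]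
    (φ : A →ₐ[ℂ] TrivSqZeroExt K K) (hφ : ∀ a, (φ a).fst = algebraMap A K a) :
    ∃ D : Derivation ℂ K K, ∀ a, D (algebraMap A K a) = (φ a).snd := by
  have : Algebra.FormallyEtale A K := .of_isLocalization (nonZeroDivisors A)
  let d : Derivation ℂ A K := Derivation.mk'
    { toFun a := (φ a).snd
      map_add' := by simp
      map_smul' := by simp } (by intro a b; simp [hφ, Algebra.smul_def, mul_comm])
  exact Derivation.exists_extend_of_formallyEtale d

section

variable {σ : Type*} [Fintype σ]

/-- The ideal of polynomials vanishing on a subset of affine space. -/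
abbrev pointIdeal (X : Set (σ → ℂ)) : Ideal (MvPolynomial σ ℂ) := idealOf (Pi.basisFun ℂ σ) X

theorem mem_pointIdeal {X : Set (σ → ℂ)} {f : MvPolynomial σ ℂ} :
    f ∈ pointIdeal X ↔ ∀ p ∈ X, MvPolynomial.eval p f = 0 := by
  simp only [mem_idealOf, Pi.basisFun_equivFun]; rfl

/-- The coordinate ring of a subset of affine space. -/
def CoordRing (X : Set (σ → ℂ)) : Type _ := MvPolynomial σ ℂ ⧸ pointIdeal X

instance (X : Set (σ → ℂ)) : CommRing (CoordRing X) :=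
  inferInstanceAs (CommRing (MvPolynomial σ ℂ ⧸ pointIdeal X))

instance (X : Set (σ → ℂ)) : Algebra ℂ (CoordRing X) :=
  inferInstanceAs (Algebra ℂ (MvPolynomial σ ℂ ⧸ pointIdeal X))

/-- The class of a polynomial in the coordinate ring. -/
def polyClass (X : Set (σ → ℂ)) : MvPolynomial σ ℂ →ₐ[ℂ] CoordRing X :=
  Ideal.Quotient.mkₐ ℂ (pointIdeal X)

theorem polyClass_surjective (X : Set (σ → ℂ)) : Function.Surjective (polyClass X) :=
  Ideal.Quotient.mk_surjective

theorem polyClass_eq_zero_iff {X : Set (σ → ℂ)} {f : MvPolynomial σ ℂ} :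
    polyClass X f = 0 ↔ f ∈ pointIdeal X :=
  Ideal.Quotient.eq_zero_iff_mem

/-- The coordinate functions. -/
def coordFun (X : Set (σ → ℂ)) (j : σ) : CoordRing X := polyClass X (MvPolynomial.X j)

theorem CoordRing.algHom_ext {X : Set (σ → ℂ)} {R : Type*} [CommRing R] [Algebra ℂ R]
    {φ ψ : CoordRing X →ₐ[ℂ] R} (h : ∀ s, φ (coordFun X s) = ψ (coordFun X s)) : φ = ψ := by
  have h1 : φ.comp (polyClass X) = ψ.comp (polyClass X) := MvPolynomial.algHom_ext h
  ext b
  obtain ⟨f, rfl⟩ := polyClass_surjective X b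
  exact congrArg (fun g => g f) h1

/-- Homomorphisms from the coordinate ring. -/
def CoordRing.lift {X : Set (σ → ℂ)} {R : Type*} [CommRing R] [Algebra ℂ R]
    (φ : MvPolynomial σ ℂ →ₐ[ℂ] R) (hφ : ∀ f ∈ pointIdeal X, φ f = 0) : CoordRing X →ₐ[ℂ] R :=
  Ideal.Quotient.liftₐ (pointIdeal X) φ hφ

/-- Evaluation of elements of the coordinate ring at a point. -/
def evalPoint (X : Set (σ → ℂ)) (p : X) : CoordRing X →ₐ[ℂ] ℂ :=
  CoordRing.lift (MvPolynomial.aeval p.1) fun f hf => by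
    simpa using mem_pointIdeal.1 hf p.1 p.2

@[simp]
theorem evalPoint_coordFun (X : Set (σ → ℂ)) (p : X) (j : σ) :
    evalPoint X p (coordFun X j) = p.1 j :=
  MvPolynomial.aeval_X _ j

theorem jointlyInjective_evalPoint (X : Set (σ → ℂ)) : JointlyInjective (evalPoint X) := by
  intro b hb
  obtain ⟨f, rfl⟩ := polyClass_surjective X b
  rw [polyClass_eq_zero_iff, mem_pointIdeal]
  intro p hp
  exact hb ⟨p, hp⟩

theorem aeval_comp_coordFun {X : Set (σ → ℂ)} {K : Type*} [CommRing K] [Algebra ℂ K]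
    (i : CoordRing X →ₐ[ℂ] K) (f : MvPolynomial σ ℂ) :
    MvPolynomial.aeval (fun j => i (coordFun X j)) f = i (polyClass X f) := by
  have : MvPolynomial.aeval (fun j => i (coordFun X j)) = i.comp (polyClass X) := by
    ext j; simp [coordFun]
  rw [this]; rfl

theorem aeval_comp_coordFun_eq_zero {X : Set (σ → ℂ)} {K : Type*} [CommRing K] [Algebra ℂ K]
    (i : CoordRing X →ₐ[ℂ] K) (f : MvPolynomial σ ℂ) (hf : f ∈ pointIdeal X) :
    MvPolynomial.aeval (fun j => i (coordFun X j)) f = 0 := by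
  rw [aeval_comp_coordFun, polyClass_eq_zero_iff.2 hf, map_zero]

/-- The restriction of a polynomial to a parametrized line. -/
def restrictLine (p c : σ → ℂ) : MvPolynomial σ ℂ →ₐ[ℂ] Polynomial ℂ :=
  MvPolynomial.aeval fun j => Polynomial.C (p j) + Polynomial.X * Polynomial.C (c j)

theorem eval_restrictLine (p c : σ → ℂ) (f : MvPolynomial σ ℂ) (t : ℂ) :
    (restrictLine p c f).eval t = MvPolynomial.eval (p + t • c) f := by
  have : (Polynomial.aeval t).comp (restrictLine p c) = MvPolynomial.aeval (p + t • c) := by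
    ext j
    simp only [restrictLine, AlgHom.comp_apply, MvPolynomial.aeval_X]
    simp
    ring
  simpa using congrArg (fun h => h f) this

theorem derivative_restrictLine (p c : σ → ℂ) (f : MvPolynomial σ ℂ) :
    (restrictLine p c f).derivative =
      restrictLine p c (∑ j, MvPolynomial.C (c j) * MvPolynomial.pderiv j f) := by
  have := (Polynomial.derivative' (R := ℂ)).map_aeval_eq_sum
    (fun j => Polynomial.C (p j) + Polynomial.X * Polynomial.C (c j)) f
  change (restrictLine p c f).derivative = _ at this
  rw [this, map_sum]
  refine Finset.sum_congr rfl fun j _ => ?_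
  change restrictLine p c _ • Polynomial.derivative _ = _
  rw [map_mul, smul_eq_mul, mul_comm]
  simp [restrictLine]

theorem IsCone.mem_tangent {X : Set (σ → ℂ)} (hX : IsCone X) {K : Type*} [CommRing K] [Algebra ℂ K]
    (i : CoordRing X →ₐ[ℂ] K) :
    (fun j => i (coordFun X j)) ∈ tangent (pointIdeal X) (fun j => i (coordFun X j)) := by
  intro f hf
  have h : ∑ j, MvPolynomial.pderiv j f * MvPolynomial.X j ∈ pointIdeal X := by
    rw [mem_pointIdeal]
    intro p hp
    have h0 : restrictLine p p f = 0 := by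
      refine Polynomial.funext fun t => ?_
      rw [eval_restrictLine, Polynomial.eval_zero]
      have := hX.2 (1 + t) p hp
      rw [add_smul, one_smul] at this
      exact mem_pointIdeal.1 hf _ this
    have h1 := congrArg (Polynomial.eval 0) (derivative_restrictLine p p f)
    rw [h0, eval_restrictLine] at h1
    simpa [mul_comm] using h1.symm
  have h1 := aeval_comp_coordFun_eq_zero i _ h
  simpa using h1

theorem add_smul_mem_of_pderiv_mem {X : Set (σ → ℂ)} (hX : IsAlgSet X) {c : σ → ℂ}
    (hc : ∀ f ∈ pointIdeal X, ∑ j, MvPolynomial.C (c j) * MvPolynomial.pderiv j f ∈ pointIdeal X)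
    {p : σ → ℂ} (hp : p ∈ X) (t : ℂ) : p + t • c ∈ X := by
  have key : ∀ n, ∀ f ∈ pointIdeal X, (restrictLine p c f).natDegree < n →
      restrictLine p c f = 0 := by
    intro n
    induction n with
    | zero => simp
    | succ n ih =>
      intro f hf hn
      have h0 : (restrictLine p c f).natDegree = 0 := by
        by_contra h
        have h1 := Polynomial.natDegree_derivative_lt h
        rw [derivative_restrictLine] at h1
        have h2 := ih _ (hc f hf) (by omega)
        rw [← derivative_restrictLine] at h2
        exact h (Polynomial.derivative_eq_zero.1 h2)
      rw [Polynomial.eq_C_of_natDegree_eq_zero h0]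
      have := eval_restrictLine p c f 0
      rw [Polynomial.eq_C_of_natDegree_eq_zero h0, Polynomial.eval_C] at this
      rw [this, zero_smul, add_zero, mem_pointIdeal.1 hf p hp, map_zero]
  rw [← hX.zeroSet_idealOf (Pi.basisFun ℂ σ)]
  intro f hf
  have h1 : MvPolynomial.eval (p + t • c) f = 0 := by
    rw [← eval_restrictLine, key _ f hf (Nat.lt_succ_self _), Polynomial.eval_zero]
  rw [Pi.basisFun_equivFun]
  exact h1

theorem Nondeg.eq_zero_of_sum_smul_coordFun {X : Set (σ → ℂ)} (hX : Nondeg X) {c : σ → ℂ}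
    (hc : ∑ j, c j • coordFun X j = 0) : c = 0 := by
  classical
  have h1 : (⊤ : Submodule ℂ (σ → ℂ)) ≤ LinearMap.ker
      (∑ j, c j • LinearMap.proj (R := ℂ) (φ := fun _ : σ => ℂ) j) := by
    rw [← hX, Submodule.span_le]
    intro p hp
    have := congrArg (evalPoint X ⟨p, hp⟩) hc
    simpa using this
  ext j
  have := h1 (x := Pi.single j 1) trivial
  simpa [Pi.single_apply] using this

end

theorem adim_zcl_range {W ι κ A K : Type*} [AddCommGroup W] [Module ℂ W] [Fintype ι]
    (e : Module.Basis ι ℂ W) [CommRing A] [Algebra ℂ A] {E : κ → A →ₐ[ℂ] ℂ}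
    (hE : JointlyInjective E) [Field K] [Algebra ℂ K] {j : A →ₐ[ℂ] K}
    (hj : Function.Injective j) (α : ι → A) :
    adim (zcl {w : W | ∃ k, ∀ i, e.equivFun w i = E k (α i)}) =
      Module.finrank K (LinearMap.range (derivationValues fun i => j (α i))) := by
  refine adim_zcl_eq_finrank e _ _ fun f => ?_
  have h1 : MvPolynomial.aeval (fun i => j (α i)) f = j (MvPolynomial.aeval α f) := by
    have : MvPolynomial.aeval (fun i => j (α i)) = j.comp (MvPolynomial.aeval α) := by
      ext; simp
    rw [this]; rfl
  have h2 : ∀ k, E k (MvPolynomial.aeval α f) = MvPolynomial.eval (fun i => E k (α i)) f := by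
    intro k
    have : MvPolynomial.aeval (fun i => E k (α i)) = (E k).comp (MvPolynomial.aeval α) := by
      ext; simp
    rw [← MvPolynomial.coe_aeval_eq_eval, RingHom.coe_coe, this]; rfl
  rw [h1, map_eq_zero_iff j hj]
  constructor
  · rintro h w ⟨k, hk⟩
    rw [show e.equivFun w = fun i => E k (α i) from funext hk, ← h2, h, map_zero]
  · intro h
    refine hE _ fun k => ?_
    rw [h2]
    have := h (e.equivFun.symm fun i => E k (α i)) ⟨k, fun i => by
      rw [LinearEquiv.apply_symm_apply]⟩
    rwa [LinearEquiv.apply_symm_apply] at this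

theorem Sec_one_eq {σ : Type*} {X : Set (σ → ℂ)} (hX : IsCone X) : Sec X 1 =
    zcl {w : σ → ℂ | ∃ p ∈ X, ∃ q ∈ X, w = p + q} := by
  unfold Sec
  congr 1
  ext w
  simp only [Set.mem_iUnion, Set.mem_ofPred_eq, SetLike.mem_coe, exists_prop]
  constructor
  · rintro ⟨p, hp, hw⟩
    obtain ⟨c, rfl⟩ := (Submodule.mem_span_range_iff_exists_fun ℂ).1 hw
    exact ⟨c 0 • p 0, hX.2 _ _ (hp 0), c 1 • p 1, hX.2 _ _ (hp 1), by simp⟩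
  · rintro ⟨p, hp, q, hq, rfl⟩
    refine ⟨![p, q], by simp [Fin.forall_fin_two, hp, hq], ?_⟩
    exact add_mem (Submodule.subset_span ⟨0, rfl⟩) (Submodule.subset_span ⟨1, rfl⟩)

section

variable {σ : Type*} [Fintype σ] {X : Set (σ → ℂ)} {K : Type*} [Field K] [Algebra ℂ K]

/-- The tangent space of `X` at the `K`-point given by a homomorphism to `K`. -/
abbrev tangentAt (i : CoordRing X →ₐ[ℂ] K) : Submodule K (σ → K) :=
  tangent (pointIdeal X) (fun s => i (coordFun X s))

/-- The first factor of a homomorphism from a tensor square. -/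
abbrev firstOf {B C R : Type*} [CommRing B] [Algebra ℂ B] [CommRing C] [Algebra ℂ C]
    [CommRing R] [Algebra ℂ R] (j : B ⊗[ℂ] C →ₐ[ℂ] R) : B →ₐ[ℂ] R :=
  j.comp Algebra.TensorProduct.includeLeft

/-- The second factor of a homomorphism from a tensor square. -/
abbrev secondOf {B C R : Type*} [CommRing B] [Algebra ℂ B] [CommRing C] [Algebra ℂ C]
    [CommRing R] [Algebra ℂ R] (j : B ⊗[ℂ] C →ₐ[ℂ] R) : C →ₐ[ℂ] R :=
  j.comp Algebra.TensorProduct.includeRight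

theorem finrank_tangentAt (hX : IsAlgSet X) {i : CoordRing X →ₐ[ℂ] K} (hi : Function.Injective i)
    (hD : ∀ v ∈ tangentAt i, ∃ D : Derivation ℂ K K, ∀ s, D (i (coordFun X s)) = v s) :
    adim X = Module.finrank K (tangentAt i) := by
  have h1 := adim_zcl_range (Pi.basisFun ℂ σ) (jointlyInjective_evalPoint X) hi (coordFun X)
  have h2 : {w : σ → ℂ | ∃ k, ∀ s, (Pi.basisFun ℂ σ).equivFun w s =
      evalPoint X k (coordFun X s)} = X := by
    ext w
    simp only [Pi.basisFun_equivFun, evalPoint_coordFun, Set.mem_ofPred_eq]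
    constructor
    · rintro ⟨p, hp⟩
      rw [show w = p.1 from funext hp]
      exact p.2
    · exact fun hw => ⟨⟨w, hw⟩, fun _ => rfl⟩
  have h3 : zcl X = X := by rw [zcl_eq_zeroSet (Pi.basisFun ℂ σ), hX.zeroSet_idealOf]
  rw [h2, h3] at h1
  rw [h1]
  have h4 : LinearMap.range (derivationValues fun s => i (coordFun X s)) = tangentAt i := by
    ext v
    constructor
    · rintro ⟨D, rfl⟩
      exact derivation_mem_tangent (aeval_comp_coordFun_eq_zero i) D
    · intro hv
      obtain ⟨D, hD⟩ := hD v hv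
      exact ⟨D, funext hD⟩
  rw [h4]

theorem finrank_tangentAt_sup (hX : IsCone X) {j : CoordRing X ⊗[ℂ] CoordRing X →ₐ[ℂ] K}
    (hj : Function.Injective j)
    (hD : ∀ v ∈ tangentAt (firstOf j), ∀ w ∈ tangentAt (secondOf j), ∃ D : Derivation ℂ K K,
      ∀ s, D (firstOf j (coordFun X s)) = v s ∧ D (secondOf j (coordFun X s)) = w s) :
    adim (Sec X 1) =
      Module.finrank K (tangentAt (firstOf j) ⊔ tangentAt (secondOf j) : Submodule K (σ → K)) := by
  have h1 := adim_zcl_range (Pi.basisFun ℂ σ) ((jointlyInjective_evalPoint X).productMap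
    (jointlyInjective_evalPoint X)) hj (fun s => coordFun X s ⊗ₜ 1 + 1 ⊗ₜ coordFun X s)
  have h2 : {w : σ → ℂ | ∃ k : X × X, ∀ s, (Pi.basisFun ℂ σ).equivFun w s =
      Algebra.TensorProduct.productMap (evalPoint X k.1) (evalPoint X k.2)
        (coordFun X s ⊗ₜ 1 + 1 ⊗ₜ coordFun X s)} =
      {w : σ → ℂ | ∃ p ∈ X, ∃ q ∈ X, w = p + q} := by
    ext w
    simp only [Pi.basisFun_equivFun, map_add, Algebra.TensorProduct.productMap_left_apply,
      Algebra.TensorProduct.productMap_right_apply, evalPoint_coordFun, Set.mem_ofPred_eq]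
    constructor
    · rintro ⟨k, hk⟩
      exact ⟨k.1, k.1.2, k.2, k.2.2, funext hk⟩
    · rintro ⟨p, hp, q, hq, rfl⟩
      exact ⟨(⟨p, hp⟩, ⟨q, hq⟩), fun _ => rfl⟩
  rw [h2] at h1
  rw [Sec_one_eq hX, h1]
  have h4 : LinearMap.range (derivationValues fun s =>
      j (coordFun X s ⊗ₜ 1 + 1 ⊗ₜ coordFun X s)) =
      tangentAt (firstOf j) ⊔ tangentAt (secondOf j) := by
    ext v
    rw [Submodule.mem_sup]
    constructor
    · rintro ⟨D, rfl⟩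
      refine ⟨_, derivation_mem_tangent (aeval_comp_coordFun_eq_zero (firstOf j)) D,
        _, derivation_mem_tangent (aeval_comp_coordFun_eq_zero (secondOf j)) D, ?_⟩
      ext s
      change _ = D (j _)
      rw [map_add, map_add]
      rfl
    · rintro ⟨v, hv, w, hw, rfl⟩
      obtain ⟨D, hD⟩ := hD v hv w hw
      refine ⟨D, funext fun s => ?_⟩
      change D (j _) = _
      rw [map_add, map_add]
      exact congrArg₂ (· + ·) (hD s).1 (hD s).2
  rw [h4]

theorem exists_algHom_dual {i : CoordRing X →ₐ[ℂ] K} {v : σ → K} (hv : v ∈ tangentAt i) :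
    ∃ φ : CoordRing X →ₐ[ℂ] TrivSqZeroExt K K,
      ∀ s, φ (coordFun X s) = TrivSqZeroExt.inl (i (coordFun X s)) + TrivSqZeroExt.inr (v s) := by
  refine ⟨CoordRing.lift (MvPolynomial.aeval (fun s => (TrivSqZeroExt.inl (i (coordFun X s)) +
    TrivSqZeroExt.inr (v s) : TrivSqZeroExt K K))) ?_, fun s => ?_⟩
  · intro f hf
    rw [aeval_inl_add_inr, aeval_comp_coordFun_eq_zero i f hf, hv f hf]
    simp
  · exact MvPolynomial.aeval_X _ s

theorem exists_derivation_pair [IsDomain (CoordRing X ⊗[ℂ] CoordRing X)]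
    [Algebra (CoordRing X ⊗[ℂ] CoordRing X) K] [IsScalarTower ℂ (CoordRing X ⊗[ℂ] CoordRing X) K]
    [IsFractionRing (CoordRing X ⊗[ℂ] CoordRing X) K]
    {j : CoordRing X ⊗[ℂ] CoordRing X →ₐ[ℂ] K} (hj : ∀ a, j a = algebraMap _ K a)
    {v w : σ → K} (hv : v ∈ tangentAt (firstOf j)) (hw : w ∈ tangentAt (secondOf j)) :
    ∃ D : Derivation ℂ K K,
      ∀ s, D (firstOf j (coordFun X s)) = v s ∧ D (secondOf j (coordFun X s)) = w s := by
  obtain ⟨φ, hφ⟩ := exists_algHom_dual hv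
  obtain ⟨ψ, hψ⟩ := exists_algHom_dual hw
  have hfst : (TrivSqZeroExt.fstHom ℂ K K).comp (Algebra.TensorProduct.productMap φ ψ) = j := by
    apply Algebra.TensorProduct.ext <;> refine CoordRing.algHom_ext fun s => ?_
    · change TrivSqZeroExt.fst (Algebra.TensorProduct.productMap φ ψ (coordFun X s ⊗ₜ 1)) = _
      rw [Algebra.TensorProduct.productMap_left_apply, hφ]
      simp
    · change TrivSqZeroExt.fst (Algebra.TensorProduct.productMap φ ψ (1 ⊗ₜ coordFun X s)) = _
      rw [Algebra.TensorProduct.productMap_right_apply, hψ]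
      simp
  obtain ⟨D, hD⟩ := exists_derivation_of_algHom_dual (Algebra.TensorProduct.productMap φ ψ)
    (fun a => by rw [← hj]; exact congrArg (fun h => h a) hfst)
  refine ⟨D, fun s => ⟨?_, ?_⟩⟩
  · refine (congrArg D (hj _)).trans ((hD (coordFun X s ⊗ₜ 1)).trans ?_)
    rw [Algebra.TensorProduct.productMap_left_apply, hφ]
    simp
  · refine (congrArg D (hj _)).trans ((hD (1 ⊗ₜ coordFun X s)).trans ?_)
    rw [Algebra.TensorProduct.productMap_right_apply, hψ]
    simp

theorem exists_derivation_triple [IsDomain ((CoordRing X ⊗[ℂ] CoordRing X) ⊗[ℂ] CoordRing X)]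
    [Algebra ((CoordRing X ⊗[ℂ] CoordRing X) ⊗[ℂ] CoordRing X) K]
    [IsScalarTower ℂ ((CoordRing X ⊗[ℂ] CoordRing X) ⊗[ℂ] CoordRing X) K]
    [IsFractionRing ((CoordRing X ⊗[ℂ] CoordRing X) ⊗[ℂ] CoordRing X) K]
    {j : (CoordRing X ⊗[ℂ] CoordRing X) ⊗[ℂ] CoordRing X →ₐ[ℂ] K}
    (hj : ∀ a, j a = algebraMap _ K a)
    {v w u : σ → K} (hv : v ∈ tangentAt (firstOf (firstOf j)))
    (hw : w ∈ tangentAt (secondOf (firstOf j))) (hu : u ∈ tangentAt (secondOf j)) :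
    ∃ D : Derivation ℂ K K,
      ∀ s, D (firstOf (firstOf j) (coordFun X s)) = v s ∧
        D (secondOf (firstOf j) (coordFun X s)) = w s ∧ D (secondOf j (coordFun X s)) = u s := by
  obtain ⟨φ, hφ⟩ := exists_algHom_dual hv
  obtain ⟨ψ, hψ⟩ := exists_algHom_dual hw
  obtain ⟨χ, hχ⟩ := exists_algHom_dual hu
  set Φ := Algebra.TensorProduct.productMap (Algebra.TensorProduct.productMap φ ψ) χ with hΦ
  have h1 : ∀ s, Φ ((coordFun X s ⊗ₜ 1) ⊗ₜ 1) = φ (coordFun X s) := fun s => by simp [hΦ]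
  have h2 : ∀ s, Φ ((1 ⊗ₜ coordFun X s) ⊗ₜ 1) = ψ (coordFun X s) := fun s => by simp [hΦ]
  have h3 : ∀ s, Φ (1 ⊗ₜ coordFun X s) = χ (coordFun X s) := fun s => by simp [hΦ]
  have hfst : (TrivSqZeroExt.fstHom ℂ K K).comp Φ = j := by
    apply Algebra.TensorProduct.ext
    · apply Algebra.TensorProduct.ext <;>
        refine CoordRing.algHom_ext fun s => ?_
      · change TrivSqZeroExt.fst (Φ ((coordFun X s ⊗ₜ 1) ⊗ₜ 1)) = _
        rw [h1, hφ]
        simp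
      · change TrivSqZeroExt.fst (Φ ((1 ⊗ₜ coordFun X s) ⊗ₜ 1)) = _
        rw [h2, hψ]
        simp
    · refine CoordRing.algHom_ext fun s => ?_
      change TrivSqZeroExt.fst (Φ (1 ⊗ₜ coordFun X s)) = _
      rw [h3, hχ]
      simp
  obtain ⟨D, hD⟩ := exists_derivation_of_algHom_dual Φ
    (fun a => by rw [← hj]; exact congrArg (fun h => h a) hfst)
  refine ⟨D, fun s => ⟨?_, ?_, ?_⟩⟩
  · refine (congrArg D (hj _)).trans ((hD ((coordFun X s ⊗ₜ 1) ⊗ₜ 1)).trans ?_)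
    rw [h1, hφ]
    simp
  · refine (congrArg D (hj _)).trans ((hD ((1 ⊗ₜ coordFun X s) ⊗ₜ 1)).trans ?_)
    rw [h2, hψ]
    simp
  · refine (congrArg D (hj _)).trans ((hD (1 ⊗ₜ coordFun X s)).trans ?_)
    rw [h3, hχ]
    simp

/-- Linear relations with coefficients in the fraction field of one tensor factor between
elements of the other factor imply linear relations with complex coefficients. -/
theorem exists_complex_relation {A B L : Type*} [CommRing A] [IsDomain A] [Algebra ℂ A]
    [CommRing B] [Algebra ℂ B] [Field L] [Algebra ℂ L] [Algebra A L] [IsScalarTower ℂ A L]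
    [IsFractionRing A L] {j : A ⊗[ℂ] B →ₐ[ℂ] K} (hj : Function.Injective j) {ρ : L →ₐ[ℂ] K}
    (hρ : ∀ a, ρ (algebraMap A L a) = firstOf j a) {ℓ : σ → L} (hℓ : ℓ ≠ 0) :
    ∃ c : σ → ℂ, c ≠ 0 ∧ ∀ b : σ → B,
      ∑ s, ρ (ℓ s) * secondOf j (b s) = 0 → ∑ s, c s • b s = 0 := by
  obtain ⟨d, hd⟩ := IsLocalization.exist_integer_multiples_of_finite (nonZeroDivisors A) ℓ
  choose a ha using hd
  obtain ⟨s₀, hs₀⟩ := Function.ne_iff.1 hℓ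
  have hd0 : algebraMap A L d ≠ 0 := by
    simp
  have ha0 : a s₀ ≠ 0 := by
    intro h
    have := ha s₀
    rw [h, map_zero] at this
    rw [Algebra.smul_def] at this
    exact (mul_ne_zero hd0 hs₀) this.symm
  obtain ⟨f, hf⟩ : ∃ f : Module.Dual ℂ A, f (a s₀) ≠ 0 := by
    by_contra! h
    exact ha0 ((Module.forall_dual_apply_eq_zero_iff ℂ _).1 h)
  refine ⟨fun s => f (a s), fun h => hf (congrFun h s₀), fun b hb => ?_⟩
  have h1 : ∑ s, a s ⊗ₜ[ℂ] b s = 0 := by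
    apply hj
    rw [map_zero, map_sum, ← mul_zero (ρ (algebraMap A L d)), ← hb, Finset.mul_sum]
    refine Finset.sum_congr rfl fun s _ => ?_
    rw [← mul_assoc, ← map_mul, ← Algebra.smul_def, ← ha s, hρ]
    change _ = j _ * j _
    rw [← map_mul]
    simp
  have h2 := congrArg (TensorProduct.lid ℂ B ∘ LinearMap.rTensor B f) h1
  simpa using h2

end

section

variable {σ : Type*} [Fintype σ] {X : Set (σ → ℂ)} {K : Type*} [Field K] [Algebra ℂ K]
  {L : Type*} [Field L] [Algebra ℂ L]

theorem map_mem_tangentAt {i : CoordRing X →ₐ[ℂ] L} (ρ : L →ₐ[ℂ] K) {v : σ → L}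
    (hv : v ∈ tangentAt i) : (fun s => ρ (v s)) ∈ tangentAt (ρ.comp i) := by
  intro f hf
  have h := congrArg ρ (hv f hf)
  simp only [aeval_comp_coordFun, map_sum, map_mul, map_zero] at h ⊢
  exact h

theorem sum_mul_eq_zero_of_mem_tangentAt {i : CoordRing X →ₐ[ℂ] L} (ρ : L →ₐ[ℂ] K) {ℓ : σ → L}
    (hℓ : ∀ v ∈ tangentAt i, ∑ s, ℓ s * v s = 0) {v : σ → K} (hv : v ∈ tangentAt (ρ.comp i)) :
    ∑ s, ρ (ℓ s) * v s = 0 := by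
  let := ρ.toRingHom.toAlgebra
  have hsmul : ∀ (a : L) (x : K), ρ a * x = a • x := fun a x => (Algebra.smul_def a x).symm
  refine (Module.forall_dual_apply_eq_zero_iff L _).1 fun f => ?_
  have hf : (fun s => f (v s)) ∈ tangentAt i := by
    intro g hg
    have h := hv g hg
    simp only [aeval_comp_coordFun] at h ⊢
    simp only [AlgHom.comp_apply, hsmul] at h
    simpa only [map_sum, map_smul, map_zero, smul_eq_mul] using congrArg f h
  simpa only [hsmul, map_sum, map_smul, smul_eq_mul] using hℓ _ hf

theorem exists_algHom_extending_firstOf {A B : Type*} [CommRing A] [IsDomain A] [Algebra ℂ A]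
    [CommRing B] [Nontrivial B] [Algebra ℂ B] [Algebra A L] [IsScalarTower ℂ A L]
    [IsFractionRing A L] {j : A ⊗[ℂ] B →ₐ[ℂ] K} (hj : Function.Injective j) :
    ∃ ρ : L →ₐ[ℂ] K, ∀ a, ρ (algebraMap A L a) = firstOf j a := by
  have hfst : Function.Injective (firstOf j) := hj.comp
    (Algebra.TensorProduct.includeLeft_injective (S := ℂ) (algebraMap ℂ B).injective)
  exact ⟨IsFractionRing.liftAlgHom hfst, fun a => IsFractionRing.lift_algebraMap hfst a⟩

theorem coordFun_notMem_tangentAt_sup (hnd : Nondeg X) [IsDomain (CoordRing X)]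
    [IsDomain (CoordRing X ⊗[ℂ] CoordRing X)]
    [Algebra (CoordRing X ⊗[ℂ] CoordRing X) L] [IsScalarTower ℂ (CoordRing X ⊗[ℂ] CoordRing X) L]
    [IsFractionRing (CoordRing X ⊗[ℂ] CoordRing X) L] {i : CoordRing X ⊗[ℂ] CoordRing X →ₐ[ℂ] L}
    (hi : ∀ a, i a = algebraMap _ L a)
    (hT : tangentAt (firstOf i) ⊔ tangentAt (secondOf i) ≠ ⊤)
    {j : (CoordRing X ⊗[ℂ] CoordRing X) ⊗[ℂ] CoordRing X →ₐ[ℂ] K} (hj : Function.Injective j) :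
    (fun s => secondOf j (coordFun X s)) ∉
      tangentAt (firstOf (firstOf j)) ⊔ tangentAt (secondOf (firstOf j)) := by
  classical
  obtain ⟨ρ, hρ⟩ := exists_algHom_extending_firstOf (L := L) hj
  have hρi : ρ.comp i = firstOf j := by
    refine AlgHom.ext fun a => ?_
    rw [AlgHom.comp_apply, hi, hρ]
  obtain ⟨φ, hφ, hle⟩ := Submodule.exists_le_ker_of_lt_top _ (lt_top_iff_ne_top.2 hT)
  set ℓ : σ → L := fun s => φ (Pi.single s 1) with hℓ
  have hφℓ : ∀ v, φ v = ∑ s, ℓ s * v s := by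
    intro v
    conv_lhs => rw [LinearMap.pi_apply_eq_sum_univ φ v]
    exact Finset.sum_congr rfl fun s _ => by
      rw [smul_eq_mul, mul_comm, hℓ]
      congr 2
      ext t
      simp [Pi.single_apply, eq_comm]
  have hℓ0 : ℓ ≠ 0 := by
    intro h
    refine hφ (LinearMap.ext fun v => ?_)
    rw [hφℓ, h]
    simp
  obtain ⟨c, hc, hrel⟩ := exists_complex_relation hj hρ hℓ0
  intro hmem
  refine hc (hnd.eq_zero_of_sum_smul_coordFun (hrel _ ?_))
  obtain ⟨v, hv, w, hw, hvw⟩ := Submodule.mem_sup.1 hmem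
  rw [← hρi] at hv hw
  have h1 := sum_mul_eq_zero_of_mem_tangentAt (i := firstOf i) ρ (ℓ := ℓ) (fun u hu => by
    rw [← hφℓ]; exact hle (Submodule.mem_sup_left hu)) hv
  have h2 := sum_mul_eq_zero_of_mem_tangentAt (i := secondOf i) ρ (ℓ := ℓ) (fun u hu => by
    rw [← hφℓ]; exact hle (Submodule.mem_sup_right hu)) hw
  have h3 : ∀ s, secondOf j (coordFun X s) = v s + w s := fun s => (congrFun hvw s).symm
  simp only [h3, mul_add, Finset.sum_add_distrib]
  rw [h1, h2, add_zero]


/-- The cyclic permutation of the factors of a triple tensor product. -/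
def cyclicTensor (B : Type*) [CommRing B] [Algebra ℂ B] :
    (B ⊗[ℂ] B) ⊗[ℂ] B ≃ₐ[ℂ] (B ⊗[ℂ] B) ⊗[ℂ] B :=
  (Algebra.TensorProduct.comm ℂ (B ⊗[ℂ] B) B).trans
    (Algebra.TensorProduct.assoc ℂ ℂ ℂ B B B).symm

theorem factors_cyclicTensor {B : Type*} [CommRing B] [Algebra ℂ B]
    (j : (B ⊗[ℂ] B) ⊗[ℂ] B →ₐ[ℂ] K) :
    firstOf (firstOf (j.comp (cyclicTensor B).toAlgHom)) = secondOf (firstOf j) ∧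
      secondOf (firstOf (j.comp (cyclicTensor B).toAlgHom)) = secondOf j ∧
      secondOf (j.comp (cyclicTensor B).toAlgHom) = firstOf (firstOf j) :=
  ⟨rfl, rfl, rfl⟩

theorem coordFun_notMem_tangentAt_sup_left (hnd : Nondeg X) [IsDomain (CoordRing X)]
    [IsDomain (CoordRing X ⊗[ℂ] CoordRing X)]
    [Algebra (CoordRing X ⊗[ℂ] CoordRing X) L] [IsScalarTower ℂ (CoordRing X ⊗[ℂ] CoordRing X) L]
    [IsFractionRing (CoordRing X ⊗[ℂ] CoordRing X) L] {i : CoordRing X ⊗[ℂ] CoordRing X →ₐ[ℂ] L}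
    (hi : ∀ a, i a = algebraMap _ L a)
    (hT : tangentAt (firstOf i) ⊔ tangentAt (secondOf i) ≠ ⊤)
    {j : (CoordRing X ⊗[ℂ] CoordRing X) ⊗[ℂ] CoordRing X →ₐ[ℂ] K} (hj : Function.Injective j) :
    (fun s => firstOf (firstOf j) (coordFun X s)) ∉
      tangentAt (secondOf (firstOf j)) ⊔ tangentAt (secondOf j) := by
  have h := coordFun_notMem_tangentAt_sup hnd hi hT
    (j := j.comp (cyclicTensor (CoordRing X)).toAlgHom) (hj.comp (cyclicTensor _).injective)
  obtain ⟨h1, h2, h3⟩ := factors_cyclicTensor j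
  rwa [h1, h2, h3] at h

theorem coordFun_notMem_tangentAt_sup_right (hnd : Nondeg X) [IsDomain (CoordRing X)]
    [IsDomain (CoordRing X ⊗[ℂ] CoordRing X)]
    [Algebra (CoordRing X ⊗[ℂ] CoordRing X) L] [IsScalarTower ℂ (CoordRing X ⊗[ℂ] CoordRing X) L]
    [IsFractionRing (CoordRing X ⊗[ℂ] CoordRing X) L] {i : CoordRing X ⊗[ℂ] CoordRing X →ₐ[ℂ] L}
    (hi : ∀ a, i a = algebraMap _ L a)
    (hT : tangentAt (firstOf i) ⊔ tangentAt (secondOf i) ≠ ⊤)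
    {j : (CoordRing X ⊗[ℂ] CoordRing X) ⊗[ℂ] CoordRing X →ₐ[ℂ] K} (hj : Function.Injective j) :
    (fun s => secondOf (firstOf j) (coordFun X s)) ∉
      tangentAt (firstOf (firstOf j)) ⊔ tangentAt (secondOf j) := by
  have h := coordFun_notMem_tangentAt_sup_left hnd hi hT
    (j := j.comp (cyclicTensor (CoordRing X)).toAlgHom) (hj.comp (cyclicTensor _).injective)
  obtain ⟨h1, h2, h3⟩ := factors_cyclicTensor j
  rwa [h1, h2, h3, sup_comm] at h

end

theorem exists_eq_combination_of_wedge_eq_zero {σ K : Type*} [Field K] {u₁ u₂ w₁ w₂ : σ → K}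
    (hu : ∀ a b : K, a • u₁ + b • u₂ = 0 → a = 0 ∧ b = 0)
    (hw : ∀ s t, w₁ s * u₂ t - w₁ t * u₂ s + (u₁ s * w₂ t - u₁ t * w₂ s) = 0) :
    ∃ a b c : K, w₁ = a • u₁ + b • u₂ ∧ w₂ = c • u₁ - a • u₂ := by
  obtain ⟨s, t, hst⟩ : ∃ s t, u₁ s * u₂ t - u₁ t * u₂ s ≠ 0 := by
    by_contra! h
    have h1 : ∀ s, u₁ s = 0 := fun s => by
      have := (hu (u₂ s) (-u₁ s) (by
        ext t
        simp only [Pi.add_apply, Pi.smul_apply, smul_eq_mul, Pi.zero_apply]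
        linear_combination -h s t)).2
      simpa using this
    exact one_ne_zero (hu 1 0 (by ext s; simp [h1])).1
  set δ := u₁ s * u₂ t - u₁ t * u₂ s with hδ
  refine ⟨(w₁ s * u₂ t - w₁ t * u₂ s) / δ, (u₁ s * w₁ t - u₁ t * w₁ s) / δ,
    (w₂ s * u₂ t - w₂ t * u₂ s) / δ, ?_, ?_⟩
  · ext x
    simp only [Pi.add_apply, Pi.smul_apply, smul_eq_mul]
    field_simp
    rw [hδ]
    linear_combination u₁ t * hw s x - u₁ s * hw t x + u₁ x * hw t s
  · ext x
    simp only [Pi.sub_apply, Pi.smul_apply, smul_eq_mul]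
    field_simp
    rw [hδ]
    linear_combination u₂ t * hw s x - u₂ s * hw t x

theorem exists_mem_inf_of_wedge_eq_zero {σ K : Type*} [Field K] [CharZero K]
    {T₁ T₂ T₃ : Submodule K (σ → K)} {ξ₁ ξ₂ ξ₃ v₁ v₂ v₃ : σ → K}
    (hξ₁ : ξ₁ ∈ T₁) (hξ₂ : ξ₂ ∈ T₂) (hξ₃ : ξ₃ ∈ T₃)
    (h₁ : ξ₁ ∉ T₂ ⊔ T₃) (h₂ : ξ₂ ∉ T₁ ⊔ T₃) (h₃ : ξ₃ ∉ T₁ ⊔ T₂)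
    (hv₁ : v₁ ∈ T₁) (hv₂ : v₂ ∈ T₂) (hv₃ : v₃ ∈ T₃) (hv : ¬(v₁ = 0 ∧ v₂ = 0 ∧ v₃ = 0))
    (hw : ∀ s t, (v₁ + v₃) s * (ξ₂ + ξ₃) t - (v₁ + v₃) t * (ξ₂ + ξ₃) s +
      ((ξ₁ + ξ₃) s * (v₂ + v₃) t - (ξ₁ + ξ₃) t * (v₂ + v₃) s) = 0) :
    ∃ v ≠ 0, v ∈ T₁ ∧ v ∈ T₂ ∧ v ∈ T₃ := by
  have key : ∀ {T S : Submodule K (σ → K)} {ξ x y : σ → K} {a : K}, ξ ∉ T ⊔ S → x ∈ T → y ∈ S →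
      a • ξ = x + y → a = 0 := by
    intro T S ξ x y a hξ hx hy h
    by_contra ha
    have := Submodule.add_mem_sup hx hy
    rw [← h] at this
    exact hξ ((Submodule.smul_mem_iff _ ha).1 this)
  have hu : ∀ a b : K, a • (ξ₁ + ξ₃) + b • (ξ₂ + ξ₃) = 0 → a = 0 ∧ b = 0 := by
    intro a b hab
    constructor
    · refine key h₁ (T₂.smul_mem (-b) hξ₂) (T₃.smul_mem (-(a + b)) hξ₃) ?_
      linear_combination (norm := module) hab
    · refine key h₂ (T₁.smul_mem (-a) hξ₁) (T₃.smul_mem (-(a + b)) hξ₃) ?_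
      linear_combination (norm := module) hab
  obtain ⟨a, b, c, hw₁, hw₂⟩ := exists_eq_combination_of_wedge_eq_zero hu hw
  have hb : b = 0 := by
    refine key h₂ (T₁.sub_mem hv₁ (T₁.smul_mem a hξ₁))
      (T₃.sub_mem hv₃ (T₃.smul_mem (a + b) hξ₃)) ?_
    linear_combination (norm := module) -hw₁
  have hc : c = 0 := by
    refine key h₁ (T₂.add_mem hv₂ (T₂.smul_mem a hξ₂))
      (T₃.sub_mem hv₃ (T₃.smul_mem (c - a) hξ₃)) ?_
    linear_combination (norm := module) -hw₂
  subst hb hc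
  have ha : 2 * a = 0 := by
    refine key h₃ (T₁.sub_mem hv₁ (T₁.smul_mem a hξ₁))
      (T₂.neg_mem (T₂.add_mem hv₂ (T₂.smul_mem a hξ₂))) ?_
    linear_combination (norm := module) hw₂ - hw₁
  have ha : a = 0 := by simpa using ha
  subst ha
  have h13 : v₁ = -v₃ := by linear_combination (norm := module) hw₁
  have h23 : v₂ = -v₃ := by linear_combination (norm := module) hw₂
  refine ⟨v₃, fun h => hv ?_, ?_, ?_, hv₃⟩
  · simp [h13, h23, h]
  · simpa [h13] using hv₁
  · simpa [h23] using hv₂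

theorem exists_dual_ι_mul_ι {σ : Type*} (s t : σ) :
    ∃ f : Module.Dual ℂ (ExteriorAlgebra ℂ (σ → ℂ)), ∀ p q : σ → ℂ,
      f (ExteriorAlgebra.ι ℂ p * ExteriorAlgebra.ι ℂ q) = p s * q t - p t * q s := by
  let g : (σ → ℂ) [⋀^Fin 2]→ₗ[ℂ] ℂ := Matrix.detRowAlternating.compLinearMap
    (LinearMap.pi ![LinearMap.proj s, LinearMap.proj t])
  let G : (n : ℕ) → (σ → ℂ) [⋀^Fin n]→ₗ[ℂ] ℂ
    | 2 => g
    | _ => 0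
  refine ⟨ExteriorAlgebra.liftAlternating G, fun p q => ?_⟩
  have h1 : ExteriorAlgebra.ι ℂ p * ExteriorAlgebra.ι ℂ q = ExteriorAlgebra.ιMulti ℂ 2 ![p, q] := by
    simp [ExteriorAlgebra.ιMulti_apply]
  rw [h1, ExteriorAlgebra.liftAlternating_apply_ιMulti]
  refine (Matrix.det_fin_two (R := ℂ) _).trans ?_
  simp

section

variable {σ : Type*} [Fintype σ]

/-- The bilinear form with complex matrix `c`, over any complex algebra. -/
def bilinForm (R : Type*) [CommRing R] [Algebra ℂ R] (c : σ → σ → ℂ) :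
    (σ → R) →ₗ[R] (σ → R) →ₗ[R] R :=
  LinearMap.mk₂ R (fun u w => ∑ s, ∑ t, c s t • (u s * w t))
    (fun u u' w => by simp [add_mul, Finset.sum_add_distrib])
    (fun a u w => by simp [mul_assoc, Finset.mul_sum])
    (fun u w w' => by simp [mul_add, Finset.sum_add_distrib])
    (fun a u w => by simp [mul_left_comm _ a, Finset.mul_sum])

theorem bilinForm_apply {R : Type*} [CommRing R] [Algebra ℂ R] (c : σ → σ → ℂ) (u w : σ → R) :
    bilinForm R c u w = ∑ s, ∑ t, c s t • (u s * w t) := rfl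

theorem map_bilinForm {R S : Type*} [CommRing R] [Algebra ℂ R] [CommRing S] [Algebra ℂ S]
    (φ : R →ₐ[ℂ] S) (c : σ → σ → ℂ) (u w : σ → R) :
    φ (bilinForm R c u w) = bilinForm S c (fun s => φ (u s)) (fun s => φ (w s)) := by
  simp [bilinForm_apply]

theorem Derivation.bilinForm {R : Type*} [CommRing R] [Algebra ℂ R] (D : Derivation ℂ R R)
    (c : σ → σ → ℂ) (u w : σ → R) : D (bilinForm R c u w) =
      _root_.bilinForm R c (fun s => D (u s)) w + _root_.bilinForm R c u (fun s => D (w s)) := by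
  simp only [bilinForm_apply, map_sum, Derivation.map_smul, Derivation.leibniz, smul_eq_mul,
    smul_add, Finset.sum_add_distrib]
  rw [add_comm]
  simp only [mul_comm]

variable [DecidableEq σ]

/-- The coordinates, with respect to a basis, of the products of basis vectors. -/
def wedgeCoeff {τ : Type*} (e : Module.Basis τ ℂ (ExteriorAlgebra ℂ (σ → ℂ))) (k : τ)
    (s t : σ) : ℂ :=
  e.repr (ExteriorAlgebra.ι ℂ (Pi.single s 1) * ExteriorAlgebra.ι ℂ (Pi.single t 1)) k

theorem repr_ι_mul_ι {τ : Type*} (e : Module.Basis τ ℂ (ExteriorAlgebra ℂ (σ → ℂ))) (k : τ)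
    (p q : σ → ℂ) : e.repr (ExteriorAlgebra.ι ℂ p * ExteriorAlgebra.ι ℂ q) k =
      bilinForm ℂ (wedgeCoeff e k) p q := by
  conv_lhs => rw [pi_eq_sum_univ' p, pi_eq_sum_univ' q]
  simp [Finset.sum_mul_sum, bilinForm_apply, wedgeCoeff, mul_assoc, mul_left_comm, mul_comm]

theorem wedge_eq_zero_of_bilinForm_eq_zero {τ : Type*} [Fintype τ]
    (e : Module.Basis τ ℂ (ExteriorAlgebra ℂ (σ → ℂ))) {K : Type*} [CommRing K] [Algebra ℂ K]
    {u₁ u₂ w₁ w₂ : σ → K}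
    (h : ∀ k, bilinForm K (wedgeCoeff e k) w₁ u₂ + bilinForm K (wedgeCoeff e k) u₁ w₂ = 0)
    (s t : σ) : w₁ s * u₂ t - w₁ t * u₂ s + (u₁ s * w₂ t - u₁ t * w₂ s) = 0 := by
  obtain ⟨f, hf⟩ := exists_dual_ι_mul_ι s t
  have hf' : ∀ p q : σ, ∑ k, f (e k) * wedgeCoeff e k p q =
      Pi.single (M := fun _ => ℂ) p 1 s * Pi.single (M := fun _ => ℂ) q 1 t -
        Pi.single (M := fun _ => ℂ) p 1 t * Pi.single (M := fun _ => ℂ) q 1 s := by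
    intro p q
    rw [← hf,
      ← e.sum_repr (ExteriorAlgebra.ι ℂ (Pi.single p 1) * ExteriorAlgebra.ι ℂ (Pi.single q 1)),
      map_sum]
    exact Finset.sum_congr rfl fun k _ => by rw [map_smul, smul_eq_mul, mul_comm]; simp [wedgeCoeff]
  have key : ∀ u w : σ → K, ∑ k, f (e k) • bilinForm K (wedgeCoeff e k) u w =
      u s * w t - u t * w s := by
    intro u w
    simp only [bilinForm_apply, Finset.smul_sum, smul_smul]
    rw [Finset.sum_comm]
    simp_rw [Finset.sum_comm (s := (Finset.univ : Finset τ)), ← Finset.sum_smul, hf', sub_smul,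
      Finset.sum_sub_distrib]
    simp [Pi.single_apply]
  rw [← key, ← key, ← Finset.sum_add_distrib]
  exact Finset.sum_eq_zero fun k _ => by rw [← smul_add, h, smul_zero]


theorem exists_tangent_wedge_eq_zero {X : Set (σ → ℂ)} {K : Type*} [Field K] [Algebra ℂ K]
    {τ : Type*} [Fintype τ] (e : Module.Basis τ ℂ (ExteriorAlgebra ℂ (σ → ℂ)))
    {j : (CoordRing X ⊗[ℂ] CoordRing X) ⊗[ℂ] CoordRing X →ₐ[ℂ] K} (hj : Function.Injective j)
    (hD : ∀ v ∈ tangentAt (firstOf (firstOf j)), ∀ w ∈ tangentAt (secondOf (firstOf j)),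
      ∀ u ∈ tangentAt (secondOf j), ∃ D : Derivation ℂ K K, ∀ s,
        D (firstOf (firstOf j) (coordFun X s)) = v s ∧
        D (secondOf (firstOf j) (coordFun X s)) = w s ∧ D (secondOf j (coordFun X s)) = u s)
    (hdim : adim (GhkCone X 1 2) < (Module.finrank K (tangentAt (firstOf (firstOf j))) +
      (Module.finrank K (tangentAt (secondOf (firstOf j))) +
      Module.finrank K (tangentAt (secondOf j))) : ℕ)) :
    ∃ v₁ ∈ tangentAt (firstOf (firstOf j)), ∃ v₂ ∈ tangentAt (secondOf (firstOf j)),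
      ∃ v₃ ∈ tangentAt (secondOf j), ¬(v₁ = 0 ∧ v₂ = 0 ∧ v₃ = 0) ∧
      ∀ s t, (v₁ + v₃) s * (secondOf (firstOf j) (coordFun X t) + secondOf j (coordFun X t)) -
          (v₁ + v₃) t * (secondOf (firstOf j) (coordFun X s) + secondOf j (coordFun X s)) +
        ((firstOf (firstOf j) (coordFun X s) + secondOf j (coordFun X s)) * (v₂ + v₃) t -
          (firstOf (firstOf j) (coordFun X t) + secondOf j (coordFun X t)) * (v₂ + v₃) s) = 0 := by
  set T₁ := tangentAt (firstOf (firstOf j))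
  set T₂ := tangentAt (secondOf (firstOf j))
  set T₃ := tangentAt (secondOf j)
  set u₁ : σ → K := fun s => firstOf (firstOf j) (coordFun X s) + secondOf j (coordFun X s) with hu₁
  set u₂ : σ → K := fun s => secondOf (firstOf j) (coordFun X s) +
    secondOf j (coordFun X s) with hu₂
  let U₁ : σ → (CoordRing X ⊗[ℂ] CoordRing X) ⊗[ℂ] CoordRing X :=
    fun s => (coordFun X s ⊗ₜ 1) ⊗ₜ 1 + 1 ⊗ₜ coordFun X s
  let U₂ : σ → (CoordRing X ⊗[ℂ] CoordRing X) ⊗[ℂ] CoordRing X :=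
    fun s => (1 ⊗ₜ coordFun X s) ⊗ₜ 1 + 1 ⊗ₜ coordFun X s
  have hjU₁ : (fun s => j (U₁ s)) = u₁ := funext fun s => map_add j _ _
  have hjU₂ : (fun s => j (U₂ s)) = u₂ := funext fun s => map_add j _ _
  let α : τ → (CoordRing X ⊗[ℂ] CoordRing X) ⊗[ℂ] CoordRing X :=
    fun k => bilinForm _ (wedgeCoeff e k) U₁ U₂
  have h1 := adim_zcl_range e (((jointlyInjective_evalPoint X).productMap
    (jointlyInjective_evalPoint X)).productMap (jointlyInjective_evalPoint X)) hj α
  have h2 : adim (zcl {w : ExteriorAlgebra ℂ (σ → ℂ) | ∃ k : (X × X) × X, ∀ i, e.equivFun w i =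
      Algebra.TensorProduct.productMap (Algebra.TensorProduct.productMap (evalPoint X k.1.1)
        (evalPoint X k.1.2)) (evalPoint X k.2) (α i)}) ≤ adim (GhkCone X 1 2) := by
    refine adim_mono (zcl_mono ?_)
    rintro w ⟨⟨⟨p, q⟩, s⟩, hw⟩
    refine ⟨![p.1, q.1, s.1], ![p.1 + s.1, q.1 + s.1], ?_, ?_, ?_⟩
    · intro i
      fin_cases i
      exacts [p.2, q.2, s.2]
    · intro i
      fin_cases i
      · exact add_mem (Submodule.subset_span ⟨0, rfl⟩) (Submodule.subset_span ⟨2, rfl⟩)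
      · exact add_mem (Submodule.subset_span ⟨1, rfl⟩) (Submodule.subset_span ⟨2, rfl⟩)
    · apply e.equivFun.injective
      ext i
      rw [hw i, map_bilinForm, Module.Basis.equivFun_apply,
        show ExteriorAlgebra.ιMulti ℂ (1 + 1) ![p.1 + s.1, q.1 + s.1] =
          ExteriorAlgebra.ι ℂ (p.1 + s.1) * ExteriorAlgebra.ι ℂ (q.1 + s.1) by
            simp [ExteriorAlgebra.ιMulti_apply], repr_ι_mul_ι]
      congr 2 <;> ext t <;> simp [U₁, U₂]
  let F : (T₁ × T₂ × T₃) →ₗ[K] (τ → K) := LinearMap.pi fun k =>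
    ((bilinForm K (wedgeCoeff e k)).flip u₂).comp (T₁.subtype.comp (LinearMap.fst K T₁ (T₂ × T₃)) +
      T₃.subtype.comp ((LinearMap.snd K T₂ T₃).comp (LinearMap.snd K T₁ (T₂ × T₃)))) +
    (bilinForm K (wedgeCoeff e k) u₁).comp
      (T₂.subtype.comp ((LinearMap.fst K T₂ T₃).comp (LinearMap.snd K T₁ (T₂ × T₃))) +
      T₃.subtype.comp ((LinearMap.snd K T₂ T₃).comp (LinearMap.snd K T₁ (T₂ × T₃))))
  have hF : ∀ x k, F x k = bilinForm K (wedgeCoeff e k) (x.1 + x.2.2 : σ → K) u₂ +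
      bilinForm K (wedgeCoeff e k) u₁ (x.2.1 + x.2.2 : σ → K) := fun _ _ => rfl
  have hFle : LinearMap.range F ≤ LinearMap.range (derivationValues fun i => j (α i)) := by
    rintro _ ⟨⟨v, w, u⟩, rfl⟩
    obtain ⟨D, hD⟩ := hD v v.2 w w.2 u u.2
    refine ⟨D, funext fun k => ?_⟩
    change D (j (α k)) = _
    rw [hF, map_bilinForm, Derivation.bilinForm, hjU₁, hjU₂]
    congr 2
    · congr 1
      ext s
      exact (congrArg D (congrFun hjU₁ s)).trans
        ((map_add D _ _).trans (congrArg₂ (· + ·) (hD s).1 (hD s).2.2))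
    · ext s
      exact (congrArg D (congrFun hjU₂ s)).trans
        ((map_add D _ _).trans (congrArg₂ (· + ·) (hD s).2.1 (hD s).2.2))
  have hker : LinearMap.ker F ≠ ⊥ := by
    intro h0
    have h3 := Submodule.finrank_mono hFle
    rw [LinearMap.finrank_range_of_inj (LinearMap.ker_eq_bot.1 h0), Module.finrank_prod,
      Module.finrank_prod] at h3
    have h4 := (h1.symm.le.trans h2).trans_lt hdim
    have h5 := Nat.cast_lt.1 h4
    omega
  obtain ⟨⟨v, w, u⟩, hx, hx0⟩ := Submodule.exists_mem_ne_zero_of_ne_bot hker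
  refine ⟨v, v.2, w, w.2, u, u.2, ?_, ?_⟩
  · rintro ⟨hv, hw, hu⟩
    exact hx0 (by ext1; exacts [Subtype.ext hv, Prod.ext (Subtype.ext hw) (Subtype.ext hu)])
  · have hx' : ∀ k, bilinForm K (wedgeCoeff e k) (v + u : σ → K) u₂ +
        bilinForm K (wedgeCoeff e k) u₁ (w + u : σ → K) = 0 := fun k =>
      (hF (v, w, u) k).symm.trans (congrFun hx k)
    exact wedge_eq_zero_of_bilinForm_eq_zero e hx'

end

section

variable {B C K : Type*} [CommRing B] [Algebra ℂ B] [CommRing C] [Algebra ℂ C] [CommRing K]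
  [Algebra ℂ K] {j : B ⊗[ℂ] C →ₐ[ℂ] K}

theorem firstOf_injective [Nontrivial C] (hj : Function.Injective j) :
    Function.Injective (firstOf j) :=
  hj.comp (Algebra.TensorProduct.includeLeft_injective (S := ℂ) (algebraMap ℂ C).injective)

theorem secondOf_injective [Nontrivial B] (hj : Function.Injective j) :
    Function.Injective (secondOf j) :=
  hj.comp (Algebra.TensorProduct.includeRight_injective (algebraMap ℂ B).injective)

end

theorem finrank_eq_of_pdim_eq {K : Type*} [Field K] {W : Type*} [AddCommGroup W] [Module ℂ W]
    {Y : Set W} {m : ℕ}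
    {V : Type*} [AddCommGroup V] [Module K V] [Module.Finite K V] {T : Submodule K V} (hT : T ≠ ⊥)
    (hY : adim Y = Module.finrank K T) (hm : pdim Y = m) : Module.finrank K T = m + 1 := by
  have h0 : 0 < Module.finrank K T := by
    rw [Module.finrank_pos_iff]
    exact Submodule.nontrivial_iff_ne_bot.2 hT
  rw [pdim, hY] at hm
  have : Module.finrank K T - 1 = m := by exact_mod_cast hm
  omega

theorem finrank_inf_eq_one {K : Type*} [Field K] {V : Type*} [AddCommGroup V] [Module K V]
    [Module.Finite K V]
    {T₁ T₂ : Submodule K V} {n : ℕ} (h₁ : Module.finrank K T₁ = n + 1)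
    (h₂ : Module.finrank K T₂ = n + 1)
    (h : Module.finrank K (T₁ ⊔ T₂ : Submodule K V) = 2 * n + 1) :
    Module.finrank K (T₁ ⊓ T₂ : Submodule K V) = 1 := by
  have := Submodule.finrank_sup_add_finrank_inf_eq T₁ T₂
  omega

section

variable {σ : Type*} [Fintype σ] {X : Set (σ → ℂ)} {K : Type*} [Field K] [Algebra ℂ K]

theorem Nondeg.coordFun_ne_zero [Nonempty σ] (hX : Nondeg X) : ∃ s, coordFun X s ≠ 0 := by
  by_contra! h
  have := hX.eq_zero_of_sum_smul_coordFun (c := fun _ => 1) (by simp [h])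
  obtain ⟨s⟩ := ‹Nonempty σ›
  exact one_ne_zero (congrFun this s)

theorem tangentAt_ne_bot [Nonempty σ] (hcone : IsCone X) (hnd : Nondeg X)
    {i : CoordRing X →ₐ[ℂ] K} (hi : Function.Injective i) : tangentAt i ≠ ⊥ := by
  intro h
  obtain ⟨s, hs⟩ := hnd.coordFun_ne_zero
  have h1 := hcone.mem_tangent i
  change _ ∈ tangentAt i at h1
  rw [h, Submodule.mem_bot] at h1
  exact hs (hi ((congrFun h1 s).trans (map_zero i).symm))

theorem exists_translation {A L : Type*} [CommRing A] [IsDomain A] [Algebra ℂ A]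
    [Field L] [Algebra ℂ L] [Algebra A L] [IsScalarTower ℂ A L]
    [IsFractionRing A L] {j : A ⊗[ℂ] CoordRing X →ₐ[ℂ] K} (hj : Function.Injective j)
    {ρ : L →ₐ[ℂ] K} (hρ : ∀ a, ρ (algebraMap A L a) = firstOf j a) {p : σ → L} (hp : p ≠ 0)
    (hpT : (fun s => ρ (p s)) ∈ tangentAt (secondOf j)) :
    ∃ c : σ → ℂ, c ≠ 0 ∧ ∀ f ∈ pointIdeal X,
      ∑ s, MvPolynomial.C (c s) * MvPolynomial.pderiv s f ∈ pointIdeal X := by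
  obtain ⟨c, hc, hrel⟩ := exists_complex_relation hj hρ hp
  refine ⟨c, hc, fun f hf => ?_⟩
  have h1 := hpT f hf
  simp only [aeval_comp_coordFun, mul_comm _ (ρ _)] at h1
  rw [← polyClass_eq_zero_iff, ← hrel _ h1]
  simp [MvPolynomial.C_mul']

theorem isConeVar_of_translation (hX : IsAlgSet X) (hcone : IsCone X) {c : σ → ℂ} (hc : c ≠ 0)
    (h : ∀ f ∈ pointIdeal X,
      ∑ s, MvPolynomial.C (c s) * MvPolynomial.pderiv s f ∈ pointIdeal X) : IsConeVar X := by
  refine ⟨c, ?_, hc, fun x hx a b => ?_⟩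
  · simpa using add_smul_mem_of_pderiv_mem hX h hcone.1 1
  · rw [add_comm]
    exact add_smul_mem_of_pderiv_mem hX h (hcone.2 b x hx) a

end

/-- If `dim G_{1,2}(X) < 3n + 2` and `dim S_1(X) = 2n < r`, then `X` is a cone. -/
theorem cone_of_degenerate_G12 (r n : ℕ) (X : Set (Fin (r + 1) → ℂ))
    (hX : IsProjVar X) (hnd : Nondeg X) (hdim : pdim X = (n : ℕ∞))
    (hG : pdim (GhkCone X 1 2) < ((3 * n + 2 : ℕ) : ℕ∞))
    (hS : pdim (Sec X 1) = ((2 * n : ℕ) : ℕ∞)) (hr : 2 * n < r) :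
    IsConeVar X := by
  obtain ⟨halg, hcone, hirr, -⟩ := hX
  have : (pointIdeal X).IsPrime := hirr.isPrime_idealOf _
  have : IsDomain (CoordRing X) :=
    inferInstanceAs (IsDomain (MvPolynomial (Fin (r + 1)) ℂ ⧸ pointIdeal X))
  have hE := jointlyInjective_evalPoint X
  have : IsDomain (CoordRing X ⊗[ℂ] CoordRing X) := hE.isDomain_tensorProduct
  have : IsDomain ((CoordRing X ⊗[ℂ] CoordRing X) ⊗[ℂ] CoordRing X) :=
    (hE.productMap hE).isDomain_tensorProduct
  let L := FractionRing (CoordRing X ⊗[ℂ] CoordRing X)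
  let K := FractionRing ((CoordRing X ⊗[ℂ] CoordRing X) ⊗[ℂ] CoordRing X)
  let i : CoordRing X ⊗[ℂ] CoordRing X →ₐ[ℂ] L := IsScalarTower.toAlgHom ℂ _ L
  let j : (CoordRing X ⊗[ℂ] CoordRing X) ⊗[ℂ] CoordRing X →ₐ[ℂ] K := IsScalarTower.toAlgHom ℂ _ K
  have hi : Function.Injective i := IsFractionRing.injective _ L
  have hj : Function.Injective j := IsFractionRing.injective _ K
  have hi' : ∀ a, i a = algebraMap _ L a := fun _ => rfl
  have hj' : ∀ a, j a = algebraMap _ K a := fun _ => rfl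
  have hfj := firstOf_injective hj
  have hDi : ∀ v ∈ tangentAt (firstOf i), ∀ w ∈ tangentAt (secondOf i), ∃ D : Derivation ℂ L L,
      ∀ s, D (firstOf i (coordFun X s)) = v s ∧ D (secondOf i (coordFun X s)) = w s :=
    fun v hv w hw => exists_derivation_pair hi' hv hw
  have hDj : ∀ v ∈ tangentAt (firstOf (firstOf j)), ∀ w ∈ tangentAt (secondOf (firstOf j)),
      ∀ u ∈ tangentAt (secondOf j), ∃ D : Derivation ℂ K K, ∀ s,
        D (firstOf (firstOf j) (coordFun X s)) = v s ∧
        D (secondOf (firstOf j) (coordFun X s)) = w s ∧ D (secondOf j (coordFun X s)) = u s :=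
    fun v hv w hw u hu => exists_derivation_triple hj' hv hw hu
  have hbot {F : Type} [Field F] [Algebra ℂ F] {k : CoordRing X →ₐ[ℂ] F}
      (hk : Function.Injective k) := tangentAt_ne_bot hcone hnd hk
  have hfin {F : Type} [Field F] [Algebra ℂ F] {k : CoordRing X →ₐ[ℂ] F}
      (hk : Function.Injective k)
      (hD : ∀ v ∈ tangentAt k, ∃ D : Derivation ℂ F F, ∀ s, D (k (coordFun X s)) = v s) :
      Module.finrank F (tangentAt k) = n + 1 :=
    finrank_eq_of_pdim_eq (hbot hk) (finrank_tangentAt halg hk hD) hdim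
  have hfin₂ {F : Type} [Field F] [Algebra ℂ F] {k : CoordRing X ⊗[ℂ] CoordRing X →ₐ[ℂ] F}
      (hk : Function.Injective k)
      (hD : ∀ v ∈ tangentAt (firstOf k), ∀ w ∈ tangentAt (secondOf k), ∃ D : Derivation ℂ F F,
        ∀ s, D (firstOf k (coordFun X s)) = v s ∧ D (secondOf k (coordFun X s)) = w s) :
      Module.finrank F (tangentAt (firstOf k)) = n + 1 ∧
      Module.finrank F (tangentAt (secondOf k)) = n + 1 ∧
      Module.finrank F (tangentAt (firstOf k) ⊔ tangentAt (secondOf k) :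
        Submodule F (Fin (r + 1) → F)) = 2 * n + 1 := by
    refine ⟨hfin (firstOf_injective hk) fun v hv => ?_,
      hfin (secondOf_injective hk) fun v hv => ?_,
      finrank_eq_of_pdim_eq
        (fun h => hbot (firstOf_injective hk) (le_bot_iff.1 (le_sup_left.trans h.le)))
        (finrank_tangentAt_sup hcone hk hD) hS⟩
    · obtain ⟨D, hD⟩ := hD v hv 0 (zero_mem _)
      exact ⟨D, fun s => (hD s).1⟩
    · obtain ⟨D, hD⟩ := hD 0 (zero_mem _) v hv
      exact ⟨D, fun s => (hD s).2⟩
  obtain ⟨hi₁, hi₂, hi₁₂⟩ := hfin₂ hi hDi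
  obtain ⟨hj₁, hj₂, hj₁₂⟩ := hfin₂ hfj fun v hv w hw => by
    obtain ⟨D, hD⟩ := hDj v hv w hw 0 (zero_mem _)
    exact ⟨D, fun s => ⟨(hD s).1, (hD s).2.1⟩⟩
  have hj₃ : Module.finrank K (tangentAt (secondOf j)) = n + 1 :=
    hfin (secondOf_injective hj) fun v hv => by
      obtain ⟨D, hD⟩ := hDj 0 (zero_mem _) 0 (zero_mem _) v hv
      exact ⟨D, fun s => (hD s).2.2⟩
  have hT : tangentAt (firstOf i) ⊔ tangentAt (secondOf i) ≠ ⊤ := by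
    intro h
    rw [h, finrank_top, Module.finrank_fin_fun] at hi₁₂
    omega
  have hlt : adim (GhkCone X 1 2) < (Module.finrank K (tangentAt (firstOf (firstOf j))) +
      (Module.finrank K (tangentAt (secondOf (firstOf j))) +
      Module.finrank K (tangentAt (secondOf j))) : ℕ) := by
    rw [hj₁, hj₂, hj₃, show n + 1 + (n + 1 + (n + 1)) = 3 * n + 2 + 1 by ring]
    refine lt_of_le_of_lt (le_tsub_add (a := 1) (b := adim (GhkCone X 1 2))) ?_
    rw [Nat.cast_add_one]
    exact (ENat.add_lt_add_iff_right ENat.one_ne_top).2 hG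
  obtain ⟨v₁, hv₁, v₂, hv₂, v₃, hv₃, hv, hw⟩ :=
    exists_tangent_wedge_eq_zero (Pi.basisFun ℂ (Fin (r + 1))).ExteriorAlgebra hj hDj hlt
  have := charZero_of_complexAlgebra K
  obtain ⟨v, hv0, hvT₁, hvT₂, hvT₃⟩ := exists_mem_inf_of_wedge_eq_zero (hcone.mem_tangent _)
    (hcone.mem_tangent _) (hcone.mem_tangent _) (coordFun_notMem_tangentAt_sup_left hnd hi' hT hj)
    (coordFun_notMem_tangentAt_sup_right hnd hi' hT hj)
    (coordFun_notMem_tangentAt_sup hnd hi' hT hj) hv₁ hv₂ hv₃ hv hw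
  obtain ⟨ρ, hρ⟩ := exists_algHom_extending_firstOf (L := L) hj
  have hρi : ρ.comp i = firstOf j := AlgHom.ext hρ
  have hLinf := finrank_inf_eq_one hi₁ hi₂ hi₁₂
  have hKinf := finrank_inf_eq_one hj₁ hj₂ hj₁₂
  obtain ⟨p, hp, hp0⟩ := Submodule.exists_mem_ne_zero_of_ne_bot
    (p := tangentAt (firstOf i) ⊓ tangentAt (secondOf i)) fun h => by
      rw [h, finrank_bot] at hLinf
      exact zero_ne_one hLinf
  have hp₁ := map_mem_tangentAt ρ hp.1
  have hp₂ := map_mem_tangentAt ρ hp.2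
  rw [← AlgHom.comp_assoc, hρi] at hp₁ hp₂
  obtain ⟨c, hc⟩ := (finrank_eq_one_iff_of_nonzero'
    (⟨v, hvT₁, hvT₂⟩ : (tangentAt (firstOf (firstOf j)) ⊓ tangentAt (secondOf (firstOf j)) :
      Submodule K (Fin (r + 1) → K))) (fun h => hv0 (congrArg Subtype.val h))).1 hKinf
      ⟨fun s => ρ (p s), hp₁, hp₂⟩
  have hp₃ : (fun s => ρ (p s)) ∈ tangentAt (secondOf j) := by
    have hcv : c • v = fun s => ρ (p s) := congrArg Subtype.val hc
    exact hcv ▸ Submodule.smul_mem _ c hvT₃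
  obtain ⟨t, ht, htX⟩ := exists_translation hj hρ hp0 hp₃
  exact isConeVar_of_translation halg hcone ht htX
end
end

section
/- Let Y be an irreducible projective variety of dimension m ≥ 2 containing a 2-dimensional family of linear subspaces of dimension m-1. Then Y itself is a linear subspace of dimension m. -/
open Submodule

noncomputable section

namespace ZariskiGeometry

section Basics

variable {W W₁ W₂ : Type*} [AddCommGroup W] [Module ℂ W] [AddCommGroup W₁] [Module ℂ W₁]
  [AddCommGroup W₂] [Module ℂ W₂]

lemma linear_mem_polyFun (f : W →ₗ[ℂ] ℂ) : (f : W → ℂ) ∈ PolyFun W :=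
  Algebra.subset_adjoin f.isLinear

lemma const_mem_polyFun (c : ℂ) : (fun _ : W => c) ∈ PolyFun W :=
  (PolyFun W).algebraMap_mem c

/-- A map is polynomial if the pullbacks of all linear functionals are polynomial functions. -/
def IsPolyMap (φ : W → W₁) : Prop := ∀ f : W₁ →ₗ[ℂ] ℂ, (fun x => f (φ x)) ∈ PolyFun W

lemma IsPolyMap.comp_mem {φ : W → W₁} (hφ : IsPolyMap φ) {f : W₁ → ℂ} (hf : f ∈ PolyFun W₁) :
    (fun x => f (φ x)) ∈ PolyFun W := by
  induction hf using Algebra.adjoin_induction with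
  | mem f hf => exact hφ (IsLinearMap.mk' f hf)
  | algebraMap c => exact const_mem_polyFun c
  | add f g _ _ hf hg => exact add_mem hf hg
  | mul f g _ _ hf hg => exact mul_mem hf hg

lemma isPolyMap_linear (φ : W →ₗ[ℂ] W₁) : IsPolyMap φ := fun f =>
  linear_mem_polyFun (f.comp φ)

lemma isPolyMap_const_add (w : W₁) (φ : W →ₗ[ℂ] W₁) : IsPolyMap fun x => w + φ x := fun f => by
  simpa using! add_mem (const_mem_polyFun (f w)) (linear_mem_polyFun (f.comp φ))

lemma isAlgSet_zero {f : W → ℂ} (hf : f ∈ PolyFun W) : IsAlgSet {x | f x = 0} :=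
  ⟨{f}, by simpa using hf, by simp⟩

lemma isAlgSet_sInter {C : Set (Set W)} (hC : ∀ X ∈ C, IsAlgSet X) : IsAlgSet (⋂₀ C) := by
  refine ⟨{f | f ∈ PolyFun W ∧ ∃ X ∈ C, ∀ x ∈ X, f x = 0}, fun f hf => hf.1, ?_⟩
  ext x
  constructor
  · rintro hx f ⟨-, X, hX, hfX⟩
    exact hfX x (hx X hX)
  · intro hx X hX
    obtain ⟨S, hS, rfl⟩ := hC X hX
    exact fun f hf => hx f ⟨hS hf, _, hX, fun y hy => hy f hf⟩

lemma _root_.IsAlgSet.inter {X X' : Set W} (hX : IsAlgSet X) (hX' : IsAlgSet X') :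
    IsAlgSet (X ∩ X') := by
  rw [← Set.sInter_pair]
  refine isAlgSet_sInter ?_
  rintro _ (rfl | rfl) <;> assumption

lemma isAlgSet_iInter {ι : Sort*} {X : ι → Set W} (hX : ∀ i, IsAlgSet (X i)) :
    IsAlgSet (⋂ i, X i) := by
  rw [← Set.sInter_range]
  refine isAlgSet_sInter ?_
  rintro _ ⟨i, rfl⟩
  exact hX i

lemma isAlgSet_empty : IsAlgSet (∅ : Set W) :=
  ⟨{fun _ => 1}, by simpa using const_mem_polyFun 1, by simp⟩

lemma _root_.IsAlgSet.union {X X' : Set W} (hX : IsAlgSet X) (hX' : IsAlgSet X') :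
    IsAlgSet (X ∪ X') := by
  obtain ⟨S, hS, rfl⟩ := hX
  obtain ⟨S', hS', rfl⟩ := hX'
  refine ⟨{f | ∃ g ∈ S, ∃ h ∈ S', f = g * h}, ?_, ?_⟩
  · rintro _ ⟨g, hg, h, hh, rfl⟩
    exact mul_mem (hS hg) (hS' hh)
  · ext x
    constructor
    · rintro (hx | hx) _ ⟨g, hg, h, hh, rfl⟩
      · simp [hx g hg]
      · simp [hx h hh]
    · intro hx
      by_contra! hcon
      simp only [Set.mem_union, Set.mem_ofPred_eq, not_or, not_forall] at hcon
      obtain ⟨⟨g, hg, hgx⟩, h, hh, hhx⟩ := hcon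
      exact mul_ne_zero hgx hhx (hx _ ⟨g, hg, h, hh, rfl⟩)

lemma isAlgSet_sUnion {C : Set (Set W)} (hfin : C.Finite) (hC : ∀ X ∈ C, IsAlgSet X) :
    IsAlgSet (⋃₀ C) := by
  induction C, hfin using Set.Finite.induction_on with
  | empty => simpa using isAlgSet_empty
  | insert _ _ ih =>
    rw [Set.sUnion_insert]
    exact (hC _ (by simp)).union (ih fun X hX => hC X (by simp [hX]))

lemma _root_.IsAlgSet.preimage {X : Set W₁} (hX : IsAlgSet X) {φ : W → W₁} (hφ : IsPolyMap φ) :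
    IsAlgSet (φ ⁻¹' X) := by
  obtain ⟨S, hS, rfl⟩ := hX
  refine ⟨{f | ∃ g ∈ S, f = fun x => g (φ x)}, ?_, ?_⟩
  · rintro _ ⟨g, hg, rfl⟩
    exact hφ.comp_mem (hS hg)
  · ext x
    constructor
    · rintro hx _ ⟨g, hg, rfl⟩
      exact hx g hg
    · exact fun hx g hg => hx _ ⟨g, hg, rfl⟩

lemma isAlgSet_submodule (U : Submodule ℂ W) : IsAlgSet (U : Set W) := by
  refine ⟨{f | ∃ g : W →ₗ[ℂ] ℂ, f = g ∧ U ≤ LinearMap.ker g}, ?_, ?_⟩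
  · rintro _ ⟨g, rfl, -⟩
    exact linear_mem_polyFun g
  · ext x
    constructor
    · rintro hx _ ⟨g, rfl, hg⟩
      exact hg hx
    · intro hx
      by_contra hxU
      obtain ⟨g, hgx, hg⟩ := Submodule.exists_le_ker_of_notMem hxU
      exact hgx (hx g ⟨g, rfl, hg⟩)

lemma isAlgSet_singleton (w : W) : IsAlgSet {w} := by
  have h := (isAlgSet_submodule (⊥ : Submodule ℂ W)).preimage
    (isPolyMap_const_add (-w) LinearMap.id)
  convert h using 1
  ext x
  simp [eq_comm]

lemma _root_.IsAlgSet.exists_separating {X : Set W} (hX : IsAlgSet X) {x : W} (hx : x ∉ X) :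
    ∃ f ∈ PolyFun W, (∀ y ∈ X, f y = 0) ∧ f x ≠ 0 := by
  obtain ⟨S, hS, rfl⟩ := hX
  simp only [Set.mem_ofPred_eq, not_forall] at hx
  obtain ⟨f, hf, hfx⟩ := hx
  exact ⟨f, hS hf, fun y hy => hy f hf, hfx⟩

lemma isAlgSet_zcl (A : Set W) : IsAlgSet (zcl A) := isAlgSet_sInter fun _ h => h.1

lemma subset_zcl (A : Set W) : A ⊆ zcl A := Set.subset_sInter fun _ h => h.2

lemma zcl_subset {A X : Set W} (hX : IsAlgSet X) (h : A ⊆ X) : zcl A ⊆ X :=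
  Set.sInter_subset_of_mem ⟨hX, h⟩

lemma zcl_mono {A B : Set W} (h : A ⊆ B) : zcl A ⊆ zcl B :=
  zcl_subset (isAlgSet_zcl B) (h.trans (subset_zcl B))

lemma _root_.IsAlgSet.zcl_eq {X : Set W} (hX : IsAlgSet X) : zcl X = X :=
  (zcl_subset hX subset_rfl).antisymm (subset_zcl X)

lemma eq_zero_on_zcl {A : Set W} {f : W → ℂ} (hf : f ∈ PolyFun W) (h : ∀ x ∈ A, f x = 0) :
    ∀ x ∈ zcl A, f x = 0 :=
  zcl_subset (isAlgSet_zero hf) h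

/-- A nonempty set on which a product of polynomial functions only vanishes identically if one
of the factors does. -/
def IsPreIrr (A : Set W) : Prop :=
  A.Nonempty ∧ ∀ f ∈ PolyFun W, ∀ g ∈ PolyFun W, (∀ x ∈ A, f x * g x = 0) →
    (∀ x ∈ A, f x = 0) ∨ ∀ x ∈ A, g x = 0

lemma IsPreIrr.isIrrAlg_zcl {A : Set W} (hA : IsPreIrr A) : IsIrrAlg (zcl A) := by
  refine ⟨hA.1.mono (subset_zcl A), isAlgSet_zcl A, fun Y Z hY hZ h => ?_⟩
  by_contra! hcon
  have hY' : ¬ A ⊆ Y := fun h' => hcon.1 (zcl_subset hY h')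
  have hZ' : ¬ A ⊆ Z := fun h' => hcon.2 (zcl_subset hZ h')
  obtain ⟨y, hyA, hy⟩ := Set.not_subset.1 hY'
  obtain ⟨z, hzA, hz⟩ := Set.not_subset.1 hZ'
  obtain ⟨f, hf, hfY, hfy⟩ := hY.exists_separating hy
  obtain ⟨g, hg, hgZ, hgz⟩ := hZ.exists_separating hz
  rcases hA.2 f hf g hg fun x hx => by
    rcases h (subset_zcl A hx) with h | h
    · simp [hfY x h]
    · simp [hgZ x h] with h | h
  · exact hfy (h y hyA)
  · exact hgz (h z hzA)

lemma _root_.IsIrrAlg.isPreIrr {X : Set W} (hX : IsIrrAlg X) : IsPreIrr X :=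
  ⟨hX.1, fun _ hf _ hg h => hX.2.2 _ _ (isAlgSet_zero hf) (isAlgSet_zero hg)
    fun x hx => mul_eq_zero.1 (h x hx)⟩

lemma IsPreIrr.isIrrAlg {X : Set W} (hX : IsPreIrr X) (h : IsAlgSet X) : IsIrrAlg X :=
  h.zcl_eq ▸ hX.isIrrAlg_zcl

lemma IsPreIrr.image2 {A : Set W} {B : Set W₁} (hA : IsPreIrr A) (hB : IsPreIrr B)
    {φ : W → W₁ → W₂} (h₁ : ∀ b, IsPolyMap fun a => φ a b) (h₂ : ∀ a, IsPolyMap (φ a)) :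
    IsPreIrr (Set.image2 φ A B) := by
  refine ⟨hA.1.image2 hB.1, fun f hf g hg h => ?_⟩
  by_contra! hcon
  obtain ⟨⟨_, ⟨a, ha, b, hb, rfl⟩, hfab⟩, _, ⟨a', ha', b', hb', rfl⟩, hgab⟩ := hcon
  have key : ∀ c ∈ B, (∀ x ∈ A, f (φ x c) = 0) ∨ ∀ x ∈ A, g (φ x c) = 0 := fun c hc =>
    hA.2 _ ((h₁ c).comp_mem hf) _ ((h₁ c).comp_mem hg) fun x hx => h _ ⟨x, hx, c, hc, rfl⟩
  rcases hB.2 _ ((h₂ a).comp_mem hf) _ ((h₂ a').comp_mem hg) fun c hc => by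
    rcases key c hc with h | h
    · simp [h a ha]
    · simp [h a' ha'] with h | h
  · exact hfab (h b hb)
  · exact hgab (h b' hb')

lemma exists_polynomial_on_line {f : W → ℂ} (hf : f ∈ PolyFun W) (x v : W) :
    ∃ p : Polynomial ℂ, ∀ t, p.eval t = f (x + t • v) := by
  induction hf using Algebra.adjoin_induction with
  | mem f hf =>
    refine ⟨Polynomial.C (f x) + Polynomial.X * Polynomial.C (f v), fun t => ?_⟩
    simp only [hf.map_add, hf.map_smul, Polynomial.eval_add, Polynomial.eval_C,
      Polynomial.eval_mul, Polynomial.eval_X, smul_eq_mul]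
  | algebraMap c => exact ⟨Polynomial.C c, fun t => by simp⟩
  | add f g _ _ hf hg =>
    obtain ⟨p, hp⟩ := hf
    obtain ⟨q, hq⟩ := hg
    exact ⟨p + q, fun t => by simp [hp, hq]⟩
  | mul f g _ _ hf hg =>
    obtain ⟨p, hp⟩ := hf
    obtain ⟨q, hq⟩ := hg
    exact ⟨p * q, fun t => by simp [hp, hq]⟩

lemma isPreIrr_of_line_mem {A : Set W} (hne : A.Nonempty)
    (hA : ∀ x ∈ A, ∀ y ∈ A, ∀ t : ℂ, x + t • (y - x) ∈ A) : IsPreIrr A := by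
  refine ⟨hne, fun f hf g hg h => ?_⟩
  by_contra! hcon
  obtain ⟨⟨x, hx, hfx⟩, y, hy, hgy⟩ := hcon
  obtain ⟨p, hp⟩ := exists_polynomial_on_line hf x (y - x)
  obtain ⟨q, hq⟩ := exists_polynomial_on_line hg x (y - x)
  have hpq : p * q = 0 := Polynomial.funext fun t => by
    simpa [hp, hq] using h _ (hA x hx y hy t)
  rcases mul_eq_zero.1 hpq with rfl | rfl
  · exact hfx (by simpa using (hp 0).symm)
  · exact hgy (by simpa using (hq 1).symm)

lemma isIrrAlg_submodule (U : Submodule ℂ W) : IsIrrAlg (U : Set W) :=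
  (isPreIrr_of_line_mem ⟨0, U.zero_mem⟩ fun _ hx _ hy t =>
    U.add_mem hx (U.smul_mem t (U.sub_mem hy hx))).isIrrAlg (isAlgSet_submodule U)

lemma isPreIrr_singleton (w : W) : IsPreIrr ({w} : Set W) :=
  ⟨⟨w, rfl⟩, by simp⟩

lemma isIrrAlg_singleton (w : W) : IsIrrAlg ({w} : Set W) :=
  (isPreIrr_singleton w).isIrrAlg (isAlgSet_singleton w)

end Basics

section Noetherian

variable {W : Type*} [AddCommGroup W] [Module ℂ W]

instance [FiniteDimensional ℂ W] : Algebra.FiniteType ℂ (PolyFun W) := by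
  classical
  rw [← Subalgebra.fg_iff_finiteType]
  let b := Module.finBasis ℂ W
  refine ⟨Finset.univ.image fun i => (b.coord i : W → ℂ), le_antisymm ?_ ?_⟩
  · refine Algebra.adjoin_mono ?_
    intro f hf
    simp only [Finset.coe_image, Finset.coe_univ, Set.image_univ, Set.mem_range] at hf
    obtain ⟨i, rfl⟩ := hf
    exact (b.coord i).isLinear
  · refine Algebra.adjoin_le ?_
    intro f hf
    have : f = ∑ i, f (b i) • (b.coord i : W → ℂ) := by
      ext x
      conv_lhs => rw [← b.sum_repr x]
      have := map_sum (IsLinearMap.mk' f hf) (fun i => b.repr x i • b i) Finset.univ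
      simp only [IsLinearMap.mk'_apply] at this
      rw [this]
      simp [hf.map_smul, mul_comm]
    rw [this]
    refine sum_mem fun i _ => Subalgebra.smul_mem _ (Algebra.subset_adjoin ?_) _
    simp

instance [FiniteDimensional ℂ W] : IsNoetherianRing (PolyFun W) :=
  Algebra.FiniteType.isNoetherianRing ℂ _

/-- The ideal of polynomial functions vanishing on a set. -/
def vanishing (X : Set W) : Ideal (PolyFun W) where
  carrier := {f | ∀ x ∈ X, f.1 x = 0}
  add_mem' hf hg x hx := by simp [hf x hx, hg x hx]
  zero_mem' := by simp
  smul_mem' c f hf x hx := by simp [hf x hx]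

lemma vanishing_lt {X X' : Set W} (hX : IsAlgSet X) (hlt : X ⊂ X') :
    vanishing X' < vanishing X := by
  refine lt_of_le_not_ge (fun f hf x hx => hf x (hlt.1 hx)) fun hle => ?_
  obtain ⟨x, hx', hx⟩ := Set.exists_of_ssubset hlt
  obtain ⟨f, hf, hfX, hfx⟩ := hX.exists_separating hx
  exact hfx (hle (x := ⟨f, hf⟩) hfX x hx')

theorem exists_finite_irreducible_decomposition [FiniteDimensional ℂ W] {X : Set W}
    (hX : IsAlgSet X) : ∃ C : Set (Set W), C.Finite ∧ (∀ T ∈ C, IsIrrAlg T) ∧ X = ⋃₀ C := by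
  induction h : vanishing X using WellFoundedGT.induction generalizing X with
  | ind I ih =>
  subst h
  by_cases hirr : IsIrrAlg X
  · exact ⟨{X}, by simp, by simpa using hirr, by simp⟩
  rcases X.eq_empty_or_nonempty with rfl | hne
  · exact ⟨∅, by simp, by simp, by simp⟩
  simp only [IsIrrAlg, hne, hX, true_and, not_forall, not_or] at hirr
  obtain ⟨Y, Z, hY, hZ, hsub, hXY, hXZ⟩ := hirr
  obtain ⟨C, hCf, hC, hCX⟩ := ih _ (vanishing_lt (hX.inter hY)
    (Set.inter_subset_left.ssubset_of_ne (by simpa using hXY))) (hX.inter hY) rfl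
  obtain ⟨C', hCf', hC', hCX'⟩ := ih _ (vanishing_lt (hX.inter hZ)
    (Set.inter_subset_left.ssubset_of_ne (by simpa using hXZ))) (hX.inter hZ) rfl
  refine ⟨C ∪ C', hCf.union hCf', ?_, ?_⟩
  · rintro T (hT | hT)
    exacts [hC T hT, hC' T hT]
  · rw [Set.sUnion_union, ← hCX, ← hCX', ← Set.inter_union_distrib_left,
      Set.inter_eq_left.2 hsub]

lemma exists_infinite_irreducible_subset [FiniteDimensional ℂ W] {X : Set W}
    (hX : IsAlgSet X) (hinf : X.Infinite) : ∃ T ⊆ X, IsIrrAlg T ∧ T.Infinite := by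
  obtain ⟨C, hCf, hC, rfl⟩ := exists_finite_irreducible_decomposition hX
  by_contra! hcon
  exact hinf (hCf.sUnion fun T hT => hcon T (Set.subset_sUnion_of_mem hT) (hC T hT))

lemma _root_.IsIrrAlg.subset_of_subset_sUnion {X : Set W} (hX : IsIrrAlg X) {C : Set (Set W)}
    (hfin : C.Finite) (hC : ∀ T ∈ C, IsAlgSet T) (h : X ⊆ ⋃₀ C) : ∃ T ∈ C, X ⊆ T := by
  induction C, hfin using Set.Finite.induction_on with
  | empty => exact absurd h (by simpa using hX.1.ne_empty)
  | @insert T C _ hfin ih =>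
    rw [Set.sUnion_insert] at h
    rcases hX.2.2 _ _ (hC T (by simp))
      (isAlgSet_sUnion hfin fun X hX => hC X (by simp [hX])) h with h | h
    · exact ⟨T, by simp, h⟩
    · obtain ⟨T', hT', h'⟩ := ih (fun X hX => hC X (by simp [hX])) h
      exact ⟨T', by simp [hT'], h'⟩

end Noetherian

section Chains

variable {W : Type*} [AddCommGroup W] [Module ℂ W]

/-- There is a strict chain of irreducible algebraic sets of length `n` ending with `X`. -/
def HasChain (n : ℕ) (X : Set W) : Prop :=
  ∃ c : Fin (n + 1) → Set W, StrictMono c ∧ (∀ i, IsIrrAlg (c i)) ∧ c (Fin.last n) = X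

lemma HasChain.isIrrAlg {n : ℕ} {X : Set W} (h : HasChain n X) : IsIrrAlg X := by
  obtain ⟨c, -, hc, rfl⟩ := h
  exact hc _

lemma _root_.IsIrrAlg.hasChain_zero {X : Set W} (hX : IsIrrAlg X) : HasChain 0 X :=
  ⟨fun _ => X, Subsingleton.strictMono (α := Fin 1) _, fun _ => hX, rfl⟩

lemma HasChain.succ {n : ℕ} {X X' : Set W} (h : HasChain n X) (hlt : X ⊂ X')
    (hX' : IsIrrAlg X') : HasChain (n + 1) X' := by
  obtain ⟨c, hmono, hc, rfl⟩ := h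
  refine ⟨Fin.snoc c X', ?_, ?_, by simp⟩
  · rw [Fin.strictMono_iff_lt_succ]
    intro i
    rw [Fin.snoc_castSucc]
    induction i using Fin.lastCases with
    | last => simpa using! hlt
    | cast i =>
      rw [Fin.succ_castSucc, Fin.snoc_castSucc]
      exact hmono Fin.castSucc_lt_succ
  · intro i
    induction i using Fin.lastCases with
    | last => simpa using hX'
    | cast i => simpa using hc i

lemma HasChain.le_adim {n : ℕ} {X Y : Set W} (h : HasChain n X) (hXY : X ⊆ Y) :
    (n : ℕ∞) ≤ adim Y := by
  obtain ⟨c, hmono, hc, rfl⟩ := h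
  exact le_sSup ⟨n, rfl, c, hmono, fun i => ⟨hc i, (hmono.monotone (Fin.le_last i)).trans hXY⟩⟩

lemma exists_hasChain_of_lt_adim {n : ℕ} {Y : Set W} (h : (n : ℕ∞) < adim Y) :
    ∃ k > n, ∃ X ⊆ Y, HasChain k X := by
  obtain ⟨_, ⟨k, rfl, c, hmono, hc⟩, hk⟩ := lt_sSup_iff.1 h
  exact ⟨k, by exact_mod_cast hk, c (Fin.last k), (hc _).2, c, hmono, fun i => (hc i).1, rfl⟩

lemma eval_mem_polyFun {ι : Type*} {f : ι → W → ℂ} (hf : ∀ i, f i ∈ PolyFun W)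
    (P : MvPolynomial ι ℂ) : (fun x => MvPolynomial.eval (fun i => f i x) P) ∈ PolyFun W := by
  induction P using MvPolynomial.induction_on with
  | C c => simpa using const_mem_polyFun c
  | add p q hp hq => simpa using! add_mem hp hq
  | mul_X p i hp => simpa using! mul_mem hp (hf i)

theorem HasChain.exists_independent {n : ℕ} {X : Set W} (h : HasChain n X) :
    ∃ f : Fin n → W → ℂ, (∀ i, f i ∈ PolyFun W) ∧ ∀ P : MvPolynomial (Fin n) ℂ,
      (∀ x ∈ X, MvPolynomial.eval (fun i => f i x) P = 0) → P = 0 := by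
  induction n generalizing X with
  | zero =>
    refine ⟨Fin.elim0, fun i => i.elim0, fun P hP => ?_⟩
    obtain ⟨x, hx⟩ := h.isIrrAlg.1
    rw [MvPolynomial.eq_C_of_isEmpty P] at hP ⊢
    simpa using hP x hx
  | succ n ih =>
    obtain ⟨c, hmono, hc, rfl⟩ := h
    obtain ⟨f, hf, hind⟩ := ih (X := c (Fin.last n).castSucc)
      ⟨fun i => c i.castSucc, hmono.comp Fin.strictMono_castSucc, fun i => hc _, rfl⟩
    have hlt : c (Fin.last n).castSucc ⊂ c (Fin.last (n + 1)) := hmono (Fin.castSucc_lt_last _)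
    obtain ⟨y, hy, hy'⟩ := Set.exists_of_ssubset hlt
    obtain ⟨g, hg, hg0, hgy⟩ := (hc (Fin.last n).castSucc).2.1.exists_separating hy'
    have hfg : ∀ i, (Fin.cons g f : Fin (n + 1) → W → ℂ) i ∈ PolyFun W :=
      Fin.cases hg hf
    have hcons : ∀ x, (fun i => (Fin.cons g f : Fin (n + 1) → W → ℂ) i x) =
        Fin.cons (g x) (fun i => f i x) := fun x => by
      ext i
      cases i using Fin.cases <;> simp
    refine ⟨Fin.cons g f, hfg, ?_⟩
    have key : ∀ d : ℕ, ∀ p : Polynomial (MvPolynomial (Fin n) ℂ), p.natDegree ≤ d →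
        (∀ x ∈ c (Fin.last (n + 1)),
          MvPolynomial.eval (Fin.cons (g x) (fun i => f i x))
            ((MvPolynomial.finSuccEquiv ℂ n).symm p) = 0) → p = 0 := by
      intro d
      induction d with
      | zero =>
        intro p hp h0
        rw [Polynomial.eq_C_of_natDegree_le_zero hp] at h0 ⊢
        have hcoeff : p.coeff 0 = 0 := hind _ fun x hx => by
          simpa [MvPolynomial.eval_eq_eval_mv_eval'] using h0 x (hlt.1 hx)
        rw [hcoeff, Polynomial.C_0]
      | succ d ihd =>
        intro p hp h0
        have hcoeff : p.coeff 0 = 0 := hind _ fun x hx => by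
          have := h0 x (hlt.1 hx)
          rw [MvPolynomial.eval_eq_eval_mv_eval', AlgEquiv.apply_symm_apply, hg0 x hx,
            ← Polynomial.coeff_zero_eq_eval_zero] at this
          simpa using this
        have hdiv : p.divX * Polynomial.X = p := by
          simpa [hcoeff] using p.divX_mul_X_add
        have hz := (hc (Fin.last (n + 1))).isPreIrr.2 _ (eval_mem_polyFun hfg
          ((MvPolynomial.finSuccEquiv ℂ n).symm p.divX)) g hg fun x hx => by
            have := h0 x hx
            rw [← hdiv, MvPolynomial.eval_eq_eval_mv_eval', AlgEquiv.apply_symm_apply] at this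
            rw [hcons, MvPolynomial.eval_eq_eval_mv_eval', AlgEquiv.apply_symm_apply]
            simpa using this
        rcases hz with hz | hz
        · rw [← hdiv, ihd p.divX (by rw [Polynomial.natDegree_divX_eq_natDegree_tsub_one]; omega)
            fun x hx => by simpa only [hcons] using hz x hx, zero_mul]
        · exact absurd (hz y hy) hgy
    intro P hP
    have := key _ (MvPolynomial.finSuccEquiv ℂ n P) le_rfl fun x hx => by
      simpa only [AlgEquiv.symm_apply_apply, hcons] using hP x hx
    simpa using this

end Chains

section Dominant

open PrimeSpectrum in
lemma exists_compl_zeroLocus_subset_range_comap {R S : Type*} [CommRing R] [IsDomain R]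
    [CommRing S] [IsDomain S] {f : R →+* S} (hf : f.FinitePresentation)
    (hinj : Function.Injective f) :
    ∃ h : R, h ≠ 0 ∧ ∀ p : PrimeSpectrum R, h ∉ p.asIdeal → p ∈ Set.range (comap f) := by
  obtain ⟨D, hD⟩ := exists_constructibleSetData_iff.2 (isConstructible_range_comap hf)
  have hbot : (⊥ : PrimeSpectrum R) ∈ D.toSet := by
    rw [hD]
    refine ⟨⊥, PrimeSpectrum.ext ?_⟩
    simpa using! (RingHom.injective_iff_ker_eq_bot f).1 hinj
  simp only [ConstructibleSetData.toSet, Set.mem_iUnion] at hbot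
  obtain ⟨C, hC, hg, hf⟩ := hbot
  refine ⟨C.f, by simpa [mem_zeroLocus] using hf, fun p hp => hD ▸ ?_⟩
  simp only [ConstructibleSetData.toSet, Set.mem_iUnion]
  refine ⟨C, hC, ?_, by simpa [mem_zeroLocus] using hp⟩
  rw [mem_zeroLocus] at hg ⊢
  intro x hx
  have : x = 0 := by simpa using hg hx
  simp [this]

lemma exists_algHom_le_ker {K S : Type*} [Field K] [IsAlgClosed K] [CommRing S] [Algebra K S]
    [Algebra.FiniteType K S] {I : Ideal S} (hI : I ≠ ⊤) :
    ∃ ψ : S →ₐ[K] K, ∀ x ∈ I, ψ x = 0 := by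
  obtain ⟨m, hm, hIm⟩ := I.exists_le_maximal hI
  let := Ideal.Quotient.field m
  have := finite_of_finite_type_of_isJacobsonRing K (S ⧸ m)
  refine ⟨(IsAlgClosed.lift (R := K) (S := S ⧸ m)).comp (Ideal.Quotient.mkₐ K m),
    fun x hx => ?_⟩
  simp [Ideal.Quotient.eq_zero_iff_mem.2 (hIm hx)]

lemma exists_algHom_extension {σ K S : Type*} [Finite σ] [Field K] [IsAlgClosed K] [CommRing S]
    [IsDomain S] [Algebra K S] [Algebra.FiniteType K S] {g : σ → S}
    (hg : AlgebraicIndependent K g) :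
    ∃ h : MvPolynomial σ K, h ≠ 0 ∧ ∀ a : σ → K, MvPolynomial.eval a h ≠ 0 →
      ∃ ψ : S →ₐ[K] K, ∀ i, ψ (g i) = a i := by
  let φ : MvPolynomial σ K →ₐ[K] S := MvPolynomial.aeval g
  have hfin : φ.toRingHom.FinitePresentation := by
    rw [← RingHom.FinitePresentation.of_finiteType]
    refine RingHom.FiniteType.of_comp_finiteType (f := algebraMap K _) ?_
    have : φ.toRingHom.comp (algebraMap K _) = algebraMap K S := φ.comp_algebraMap
    rw [this, RingHom.finiteType_algebraMap]
    infer_instance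
  obtain ⟨h, h0, hext⟩ := exists_compl_zeroLocus_subset_range_comap hfin hg
  refine ⟨h, h0, fun a ha => ?_⟩
  obtain ⟨q, hq⟩ := hext ⟨RingHom.ker (MvPolynomial.eval a), RingHom.ker_isPrime _⟩ ha
  obtain ⟨ψ, hψ⟩ := exists_algHom_le_ker (K := K) q.2.ne_top
  refine ⟨ψ, fun i => ?_⟩
  have hmem : MvPolynomial.X i - MvPolynomial.C (a i) ∈
      (PrimeSpectrum.comap φ.toRingHom q).asIdeal := by
    rw [hq]
    simp [RingHom.mem_ker]
  have := hψ _ hmem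
  simpa [φ, sub_eq_zero] using! this

end Dominant

section CoordRing

variable {W : Type*} [AddCommGroup W] [Module ℂ W]

/-- Restriction of functions to a subset. -/
def restrictHom (X : Set W) : (W → ℂ) →ₐ[ℂ] (X → ℂ) :=
  AlgHom.pi fun x : X => Pi.evalAlgHom ℂ _ x.1

/-- The ring of restrictions of polynomial functions to a subset. -/
def CoordRing (X : Set W) : Subalgebra ℂ (X → ℂ) := (PolyFun W).map (restrictHom X)

/-- The restriction homomorphism to the coordinate ring. -/
def toCoordRing (X : Set W) : PolyFun W →ₐ[ℂ] CoordRing X :=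
  ((restrictHom X).comp (PolyFun W).val).codRestrict _ fun f => ⟨f.1, f.2, rfl⟩

lemma toCoordRing_apply {X : Set W} (f : PolyFun W) (x : X) : (toCoordRing X f).1 x = f.1 x.1 :=
  rfl

lemma toCoordRing_surjective (X : Set W) : Function.Surjective (toCoordRing X) := by
  rintro ⟨_, f, hf, rfl⟩
  exact ⟨⟨f, hf⟩, rfl⟩

lemma toCoordRing_eq_iff {X : Set W} {f g : PolyFun W} :
    toCoordRing X f = toCoordRing X g ↔ ∀ x ∈ X, f.1 x = g.1 x := by
  rw [Subtype.ext_iff, funext_iff, Subtype.forall]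
  rfl

lemma IsPreIrr.isDomain {X : Set W} (hX : IsPreIrr X) : IsDomain (CoordRing X) := by
  obtain ⟨x, hx⟩ := hX.1
  have : Nontrivial (CoordRing X) := ⟨0, 1, fun h => by
    have := congrFun (congrArg Subtype.val h) ⟨x, hx⟩
    simp at this⟩
  have : NoZeroDivisors (CoordRing X) := by
    refine ⟨fun {a b} hab => ?_⟩
    obtain ⟨f, rfl⟩ := toCoordRing_surjective X a
    obtain ⟨g, rfl⟩ := toCoordRing_surjective X b
    rw [← map_mul, ← map_zero (toCoordRing X), toCoordRing_eq_iff] at hab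
    rw [← map_zero (toCoordRing X), toCoordRing_eq_iff, toCoordRing_eq_iff]
    exact hX.2 f.1 f.2 g.1 g.2 hab
  exact NoZeroDivisors.to_isDomain _

instance [FiniteDimensional ℂ W] (X : Set W) : Algebra.FiniteType ℂ (CoordRing X) :=
  Algebra.FiniteType.of_surjective (toCoordRing X) (toCoordRing_surjective X)

lemma exists_point_of_algHom [FiniteDimensional ℂ W] {X : Set W} (hX : IsAlgSet X)
    (ψ : CoordRing X →ₐ[ℂ] ℂ) : ∃ x ∈ X, ∀ f : PolyFun W, ψ (toCoordRing X f) = f.1 x := by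
  let L : Module.Dual ℂ (Module.Dual ℂ W) :=
    { toFun := fun f => ψ (toCoordRing X ⟨f, linear_mem_polyFun f⟩)
      map_add' := fun f g => by
        rw [← map_add, ← map_add]
        rfl
      map_smul' := fun c f => by
        rw [RingHom.id_apply, ← map_smul, ← map_smul]
        rfl }
  obtain ⟨x, hx⟩ := (Module.evalEquiv ℂ W).surjective L
  have key : ∀ f (hf : f ∈ PolyFun W), ψ (toCoordRing X ⟨f, hf⟩) = f x := by
    intro f hf
    induction hf using Algebra.adjoin_induction with
    | mem f hf => exact (LinearMap.congr_fun hx (IsLinearMap.mk' f hf)).symm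
    | algebraMap c => exact (ψ.comp (toCoordRing X)).commutes c
    | add f g hf hg ihf ihg =>
      exact (map_add (ψ.comp (toCoordRing X)) ⟨f, hf⟩ ⟨g, hg⟩).trans (congrArg₂ _ ihf ihg)
    | mul f g hf hg ihf ihg =>
      exact (map_mul (ψ.comp (toCoordRing X)) ⟨f, hf⟩ ⟨g, hg⟩).trans (congrArg₂ _ ihf ihg)
  refine ⟨x, ?_, fun f => key f.1 f.2⟩
  by_contra hxX
  obtain ⟨f, hf, hfX, hfx⟩ := hX.exists_separating hxX
  refine hfx ?_
  rw [← key f hf, show toCoordRing X ⟨f, hf⟩ = 0 from ?_, map_zero]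
  rw [← map_zero (toCoordRing X), toCoordRing_eq_iff]
  exact hfX

lemma transcendental_of_not_const {X : Set W} (hX : IsPreIrr X) (f : PolyFun W)
    (hf : ¬ ∃ c, ∀ x ∈ X, f.1 x = c) : Transcendental ℂ (toCoordRing X f) := by
  intro halg
  have := hX.isDomain
  have hfint : IsIntegral ℂ (toCoordRing X f) := halg.isIntegral
  have hdeg := IsAlgClosed.degree_eq_one_of_irreducible ℂ (minpoly.irreducible hfint)
  have hroot := minpoly.aeval ℂ (toCoordRing X f)
  rw [Polynomial.eq_X_add_C_of_degree_eq_one hdeg, (minpoly.monic hfint).leadingCoeff,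
    Polynomial.C_1, one_mul, map_add, Polynomial.aeval_X, Polynomial.aeval_C,
    ← (toCoordRing X).commutes, ← map_add, ← map_zero (toCoordRing X), toCoordRing_eq_iff] at hroot
  exact hf ⟨_, fun x hx => eq_neg_of_add_eq_zero_left (hroot x hx)⟩

theorem exists_infinite_fibre [FiniteDimensional ℂ W] {X : Set W} (hX : IsIrrAlg X)
    (htr : 2 ≤ Algebra.trdeg ℂ (CoordRing X)) {f : W → ℂ} (hf : f ∈ PolyFun W)
    (hnc : ¬ ∃ c, ∀ x ∈ X, f x = c) : ∃ c, {x ∈ X | f x = c}.Infinite := by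
  have := hX.isPreIrr.isDomain
  have htrans := transcendental_of_not_const hX.isPreIrr ⟨f, hf⟩ hnc
  obtain ⟨s, hs, hbasis⟩ := exists_isTranscendenceBasis_superset (R := ℂ)
    (s := {toCoordRing X ⟨f, hf⟩}) ((algebraicIndependent_unique_type_iff
      (ι := ({toCoordRing X ⟨f, hf⟩} : Set (CoordRing X)))).2 htrans)
  have hcard : 1 < Cardinal.mk s := by
    rw [hbasis.cardinalMk_eq_trdeg]
    exact lt_of_lt_of_le (by norm_num) htr
  have : Nontrivial s := Cardinal.one_lt_iff_nontrivial.1 hcard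
  obtain ⟨⟨g, hgs⟩, hgf⟩ := exists_ne (⟨toCoordRing X ⟨f, hf⟩, hs rfl⟩ : s)
  have hind : AlgebraicIndependent ℂ ![toCoordRing X ⟨f, hf⟩, g] := by
    have := hbasis.1.comp ![⟨toCoordRing X ⟨f, hf⟩, hs rfl⟩, ⟨g, hgs⟩] (by
      intro i j
      fin_cases i <;> fin_cases j <;> simp [hgf, hgf.symm])
    convert this using 1
    ext i : 1
    fin_cases i <;> rfl
  obtain ⟨g, rfl⟩ := toCoordRing_surjective X g
  obtain ⟨h, h0, hext⟩ := exists_algHom_extension hind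
  obtain ⟨a, ha⟩ : ∃ a, MvPolynomial.eval a h ≠ 0 := by
    by_contra! hcon
    exact h0 (MvPolynomial.funext fun a => by simpa using hcon a)
  refine ⟨a 0, ?_⟩
  obtain ⟨p, hp⟩ : ∃ p : Polynomial ℂ, ∀ t, p.eval t = MvPolynomial.eval ![a 0, t] h := by
    refine ⟨MvPolynomial.aeval ![Polynomial.C (a 0), Polynomial.X] h, fun t => ?_⟩
    rw [← Polynomial.coe_aeval_eq_eval, ← MvPolynomial.aeval_eq_eval, ← AlgHom.comp_apply,
      MvPolynomial.comp_aeval]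
    congr 2
    ext i
    fin_cases i <;> simp
  have hp0 : p ≠ 0 := by
    rintro rfl
    refine ha ?_
    rw [show a = ![a 0, a 1] by ext i; fin_cases i <;> rfl, ← hp]
    simp
  have hinf : {t | p.eval t ≠ 0}.Infinite :=
    (Polynomial.finite_setOfPred_isRoot hp0).infinite_compl
  refine Set.Infinite.of_image g.1 (hinf.mono fun t ht => ?_)
  obtain ⟨ψ, hψ⟩ := hext ![a 0, t] (hp t ▸ ht)
  obtain ⟨x, hx, hxψ⟩ := exists_point_of_algHom hX.2.1 ψ
  exact ⟨x, ⟨hx, by simpa using! (hxψ ⟨f, hf⟩).symm.trans (hψ 0)⟩,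
    by simpa using! (hxψ g).symm.trans (hψ 1)⟩

lemma trdeg_coordRing_of_subsingleton {X : Set W} (hX : IsPreIrr X) (hs : X.Subsingleton) :
    Algebra.trdeg ℂ (CoordRing X) = 0 := by
  have := hX.isDomain
  have : Algebra.IsAlgebraic ℂ (CoordRing X) := ⟨fun a => by
    obtain ⟨f, rfl⟩ := toCoordRing_surjective X a
    obtain ⟨x, hx⟩ := hX.1
    rw [show toCoordRing X f = algebraMap ℂ _ (f.1 x) from ?_]
    · exact isAlgebraic_algebraMap _
    · rw [← (toCoordRing X).commutes, toCoordRing_eq_iff]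
      rintro y hy
      rw [hs hy hx]
      rfl⟩
  exact trdeg_eq_zero

theorem two_le_trdeg_coordRing {W₁ : Type*} [AddCommGroup W₁] [Module ℂ W₁] {X : Set W}
    (hX : IsPreIrr X) {φ : W → W₁} (hφ : IsPolyMap φ) {n : ℕ} (hn : 3 ≤ n)
    {f : Fin n → W₁ → ℂ} (hf : ∀ i, f i ∈ PolyFun W₁)
    (hind : ∀ P : MvPolynomial (Fin n) ℂ,
      (∀ x ∈ X, ∀ t : ℂ, MvPolynomial.eval (fun i => f i (t • φ x)) P = 0) → P = 0) :
    2 ≤ Algebra.trdeg ℂ (CoordRing X) := by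
  have := hX.isDomain
  let ev (t : ℂ) (x : X) : Polynomial (CoordRing X) →ₐ[ℂ] ℂ :=
    ((Pi.evalAlgHom ℂ _ x).comp (CoordRing X).val).comp
      ((Polynomial.aeval (algebraMap ℂ (CoordRing X) t)).restrictScalars ℂ)
  have hlift : ∀ g ∈ PolyFun W₁, ∃ p : Polynomial (CoordRing X), ∀ t x,
      ev t x p = g (t • φ x) := by
    intro g hg
    induction hg using Algebra.adjoin_induction with
    | mem g hg =>
      refine ⟨Polynomial.X * Polynomial.C (toCoordRing X ⟨_, hφ (IsLinearMap.mk' g hg)⟩),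
        fun t x => ?_⟩
      rw [hg.map_smul, map_mul]
      simp [ev, toCoordRing_apply]
    | algebraMap c => exact ⟨algebraMap _ _ c, fun t x => (ev t x).commutes c⟩
    | add g h _ _ ihg ihh =>
      obtain ⟨p, hp⟩ := ihg
      obtain ⟨q, hq⟩ := ihh
      exact ⟨p + q, fun t x => by simp [hp, hq]⟩
    | mul g h _ _ ihg ihh =>
      obtain ⟨p, hp⟩ := ihg
      obtain ⟨q, hq⟩ := ihh
      exact ⟨p * q, fun t x => by simp [hp, hq]⟩
  choose p hp using fun i => hlift (f i) (hf i)
  have hpind : AlgebraicIndependent ℂ p := by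
    rw [algebraicIndependent_iff]
    intro P hP
    refine hind P fun x hx t => ?_
    have := congrArg (ev t ⟨x, hx⟩) hP
    rw [map_zero, ← AlgHom.comp_apply, MvPolynomial.comp_aeval] at this
    simpa only [hp] using! this
  have : FaithfulSMul ℂ (CoordRing X) := (faithfulSMul_iff_algebraMap_injective _ _).2
    (algebraMap ℂ (CoordRing X)).injective
  have : FaithfulSMul (CoordRing X) (Polynomial (CoordRing X)) :=
    (faithfulSMul_iff_algebraMap_injective _ _).2 Polynomial.C_injective
  have h3 := hpind.lift_cardinalMk_le_trdeg
  rw [← trdeg_add_eq ℂ (CoordRing X), Polynomial.trdeg_of_isDomain] at h3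
  have h3' : (3 : Cardinal) ≤ Algebra.trdeg ℂ (CoordRing X) + 1 := by
    refine le_trans ?_ (by simpa using h3)
    exact_mod_cast hn
  rw [show (3 : Cardinal) = 2 + 1 by norm_num] at h3'
  exact Cardinal.add_one_le_add_one_iff.1 h3'

end CoordRing

section Frames

variable {ι : Type*} {m : ℕ}

/-- The linear map `b ↦ ∑ i, u i • b i` on tuples of vectors. -/
def combine (V : Type*) [AddCommGroup V] [Module ℂ V] (u : Fin m → ℂ) : (Fin m → V) →ₗ[ℂ] V :=
  ∑ i, u i • LinearMap.proj i

lemma combine_apply {V : Type*} [AddCommGroup V] [Module ℂ V] (u : Fin m → ℂ) (b : Fin m → V) :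
    combine V u b = ∑ i, u i • b i := by
  simp [combine, LinearMap.sum_apply]

lemma combine_eq_linearCombination {V : Type*} [AddCommGroup V] [Module ℂ V] (u : Fin m → ℂ)
    (b : Fin m → V) : combine V u b = Fintype.linearCombination ℂ b u := by
  rw [combine_apply, Fintype.linearCombination_apply]

lemma combine_single {V : Type*} [AddCommGroup V] [Module ℂ V] (i : Fin m) (b : Fin m → V) :
    combine V (Pi.single i 1) b = b i := by
  simp [combine_eq_linearCombination]

lemma mem_span_range_iff_combine {V : Type*} [AddCommGroup V] [Module ℂ V] {b : Fin m → V}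
    {x : V} : x ∈ span ℂ (Set.range b) ↔ ∃ u, combine V u b = x := by
  simp_rw [combine_eq_linearCombination, ← Fintype.range_linearCombination, LinearMap.mem_range]

/-- A tuple of vectors whose coordinates at the positions `e` form the identity matrix. -/
def IsNormalized (e : Fin m → ι) (b : Fin m → ι → ℂ) : Prop :=
  ∀ i j, b i (e j) = if i = j then 1 else 0

lemma IsNormalized.combine_apply {e : Fin m → ι} {b : Fin m → ι → ℂ} (hb : IsNormalized e b)
    (u : Fin m → ℂ) (j : Fin m) : combine (ι → ℂ) u b (e j) = u j := by
  simp [ZariskiGeometry.combine_apply, hb _ j]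

lemma IsNormalized.eq_combine {e : Fin m → ι} {b : Fin m → ι → ℂ} (hb : IsNormalized e b)
    {x : ι → ℂ} (hx : x ∈ span ℂ (Set.range b)) : x = combine (ι → ℂ) (fun j => x (e j)) b := by
  obtain ⟨u, rfl⟩ := mem_span_range_iff_combine.1 hx
  simp_rw [hb.combine_apply]

lemma IsNormalized.eq_of_mem_span {e : Fin m → ι} {b b' : Fin m → ι → ℂ} (hb : IsNormalized e b)
    (hb' : IsNormalized e b') {i : Fin m} (h : b' i ∈ span ℂ (Set.range b)) : b' i = b i := by
  rw [hb.eq_combine h]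
  conv_rhs => rw [hb.eq_combine (subset_span ⟨i, rfl⟩)]
  simp_rw [hb i, hb' i]

lemma IsNormalized.eq_of_span_eq {e : Fin m → ι} {b b' : Fin m → ι → ℂ} (hb : IsNormalized e b)
    (hb' : IsNormalized e b') (h : span ℂ (Set.range b') = span ℂ (Set.range b)) : b' = b :=
  funext fun i => hb.eq_of_mem_span hb' (h ▸ subset_span ⟨i, rfl⟩)

lemma IsNormalized.linearIndependent {e : Fin m → ι} {b : Fin m → ι → ℂ}
    (hb : IsNormalized e b) : LinearIndependent ℂ b := by
  rw [Fintype.linearIndependent_iff]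
  intro u hu j
  rw [← ZariskiGeometry.combine_apply] at hu
  simpa [hu] using (hb.combine_apply u j).symm

/-- The union of the affine subspaces of combinations of `b ∈ X` whose coefficients from the
index `j` on are prescribed. -/
def sweep (X : Set (Fin m → ι → ℂ)) (u : Fin m → ℂ) (j : ℕ) : Set (ι → ℂ) :=
  Set.image2 (fun b v => combine (ι → ℂ) v b) X {v | ∀ i : Fin m, j ≤ i → v i = u i}

lemma IsPreIrr.sweep {X : Set (Fin m → ι → ℂ)} (hX : IsPreIrr X) (u : Fin m → ℂ) (j : ℕ) :
    IsPreIrr (sweep X u j) := by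
  refine hX.image2 (isPreIrr_of_line_mem ⟨u, by simp⟩ ?_) (fun v => isPolyMap_linear _)
    fun b => ?_
  · intro x hx y hy t i hi
    simp [hx i hi, hy i hi]
  · simp_rw [combine_eq_linearCombination]
    exact isPolyMap_linear _

lemma sweep_mono (X : Set (Fin m → ι → ℂ)) (u : Fin m → ℂ) : Monotone (sweep X u) :=
  fun _ _ hjk => Set.image2_subset_left fun _ hv i hi => hv i (hjk.trans hi)

lemma sweep_zero (X : Set (Fin m → ι → ℂ)) (u : Fin m → ℂ) :
    sweep X u 0 = combine (ι → ℂ) u '' X := by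
  have : {v : Fin m → ℂ | ∀ i : Fin m, 0 ≤ (i : ℕ) → v i = u i} = {u} := by
    ext v
    simp [funext_iff]
  rw [sweep, this, Set.image2_singleton_right]

lemma sweep_subset {X : Set (Fin m → ι → ℂ)} {Y : Set (ι → ℂ)}
    (hX : ∀ b ∈ X, (span ℂ (Set.range b) : Set (ι → ℂ)) ⊆ Y) (u : Fin m → ℂ) (j : ℕ) :
    sweep X u j ⊆ Y := by
  rintro _ ⟨b, hb, v, -, rfl⟩
  exact hX b hb (mem_span_range_iff_combine.2 ⟨v, rfl⟩)

lemma isAlgSet_coord (k : ι) (c : ℂ) : IsAlgSet {w : ι → ℂ | w k = c} :=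
  (isAlgSet_singleton c).preimage (isPolyMap_linear (LinearMap.proj (R := ℂ) (φ := fun _ => ℂ) k))

theorem hasChain_zcl_sweep {X : Set (Fin m → ι → ℂ)} (hX : IsPreIrr X) {e : Fin m → ι}
    (he : ∀ b ∈ X, IsNormalized e b) {u : Fin m → ℂ} {n : ℕ}
    (h : HasChain n (zcl (sweep X u 0))) {j : ℕ} (hj : j ≤ m) :
    HasChain (n + j) (zcl (sweep X u j)) := by
  induction j with
  | zero => exact h
  | succ j ih =>
    refine (ih (by omega)).succ ⟨zcl_mono (sweep_mono X u j.le_succ), fun hle => ?_⟩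
      (hX.sweep u _).isIrrAlg_zcl
    have hsub : zcl (sweep X u j) ⊆ {w | w (e ⟨j, hj⟩) = u ⟨j, hj⟩} := by
      refine zcl_subset (isAlgSet_coord _ _) ?_
      rintro _ ⟨b, hb, v, hv, rfl⟩
      exact ((he b hb).combine_apply _ _).trans (hv ⟨j, hj⟩ le_rfl)
    obtain ⟨b, hb⟩ := hX.1
    have hmem : combine (ι → ℂ) (u + Pi.single ⟨j, hj⟩ 1) b ∈ sweep X u (j + 1) := by
      refine ⟨b, hb, _, fun i hi => ?_, rfl⟩
      have : i ≠ ⟨j, hj⟩ := by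
        rintro rfl
        simp at hi
      simp [this]
    have := hsub (hle (subset_zcl _ hmem))
    rw [Set.mem_ofPred_eq, (he b hb).combine_apply] at this
    simp at this

lemma IsNormalized.hasChain_span {e : Fin m → ι} {b : Fin m → ι → ℂ} (hb : IsNormalized e b) :
    HasChain m (span ℂ (Set.range b) : Set (ι → ℂ)) := by
  have h0 : HasChain 0 (zcl (sweep {b} (0 : Fin m → ℂ) 0)) :=
    ((isPreIrr_singleton b).sweep 0 0).isIrrAlg_zcl.hasChain_zero
  have := hasChain_zcl_sweep (isPreIrr_singleton b) (e := e) (by simpa using hb) h0 le_rfl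
  have hs : sweep {b} (0 : Fin m → ℂ) m = (span ℂ (Set.range b) : Set (ι → ℂ)) := by
    ext x
    rw [SetLike.mem_coe, mem_span_range_iff_combine]
    simp [sweep, fun i : Fin m => i.2.not_ge]
  rwa [zero_add, hs, (isAlgSet_submodule _).zcl_eq] at this

variable {Y : Set (ι → ℂ)}

lemma IsNormalized.span_eq_or_eq {e : Fin m → ι} {b : Fin m → ι → ℂ} (hb : IsNormalized e b)
    (hY : IsIrrAlg Y) (hdim : adim Y ≤ (m + 1 : ℕ)) {T : Set (ι → ℂ)} (hT : IsIrrAlg T)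
    (hbT : (span ℂ (Set.range b) : Set (ι → ℂ)) ⊆ T) (hTY : T ⊆ Y) :
    T = span ℂ (Set.range b) ∨ T = Y := by
  by_contra! hcon
  have := ((hb.hasChain_span.succ (hbT.ssubset_of_ne hcon.1.symm) hT).succ
    (hTY.ssubset_of_ne hcon.2) hY).le_adim subset_rfl
  have := this.trans hdim
  norm_cast at this
  omega

theorem finite_coord_fibre [Finite ι] {X : Set (Fin m → ι → ℂ)} (hX : IsPreIrr X) {e : Fin m → ι}
    (he : ∀ b ∈ X, IsNormalized e b) (hXY : ∀ b ∈ X, (span ℂ (Set.range b) : Set (ι → ℂ)) ⊆ Y)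
    (hYalg : IsAlgSet Y) (hdim : adim Y ≤ (m + 1 : ℕ)) {u : Fin m → ℂ} {k : ι}
    (hnc : ¬ ∃ c, ∀ b ∈ X, combine (ι → ℂ) u b k = c) (c : ℂ) :
    {w ∈ zcl (combine (ι → ℂ) u '' X) | w k = c}.Finite := by
  by_contra hinf
  obtain ⟨T, hTsub, hT, hTinf⟩ := exists_infinite_irreducible_subset
    ((isAlgSet_zcl (combine (ι → ℂ) u '' X)).inter (isAlgSet_coord k c)) hinf
  obtain ⟨w, hw⟩ := hT.1
  have h1 : HasChain 1 T := (isIrrAlg_singleton w).hasChain_zero.succ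
    ((Set.singleton_subset_iff.2 hw).ssubset_of_ne fun h =>
      hTinf (h ▸ Set.finite_singleton w)) hT
  have h2 : HasChain 2 (zcl (sweep X u 0)) := by
    refine h1.succ ?_ (hX.sweep u 0).isIrrAlg_zcl
    rw [sweep_zero]
    refine ⟨fun x hx => (hTsub hx).1, fun hle => hnc ⟨c, fun b hb => ?_⟩⟩
    exact (hTsub (hle (subset_zcl _ ⟨b, hb, rfl⟩))).2
  have := ((hasChain_zcl_sweep hX he h2 le_rfl).le_adim
    (zcl_subset hYalg (sweep_subset hXY u m))).trans hdim
  norm_cast at this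
  omega

theorem add_smul_mem_of_infinite [Finite ι] (hY : IsIrrAlg Y) (hdim : adim Y ≤ (m + 1 : ℕ))
    {e : Fin m → ι} {A : Set (Fin m → ι → ℂ)} (hA : A.Infinite) (he : ∀ b ∈ A, IsNormalized e b)
    (hAY : ∀ b ∈ A, (span ℂ (Set.range b) : Set (ι → ℂ)) ⊆ Y) {y : ι → ℂ}
    (hy : ∀ b ∈ A, y ∈ span ℂ (Set.range b)) {z : ι → ℂ} (hz : z ∈ Y) (a : ℂ) : z + a • y ∈ Y := by
  set Z : Set (ι → ℂ) := ⋃ b ∈ A, (span ℂ (Set.range b) : Set (ι → ℂ)) with hZ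
  have hZY : zcl Z ⊆ Y := zcl_subset hY.2.1 (Set.iUnion₂_subset hAY)
  have hZeq : zcl Z = Y := by
    obtain ⟨C, hCfin, hC, hZC⟩ := exists_finite_irreducible_decomposition (isAlgSet_zcl Z)
    by_contra hne
    have hspan : ∀ b ∈ A, (span ℂ (Set.range b) : Set (ι → ℂ)) ∈ C := by
      intro b hb
      obtain ⟨T, hTC, hbT⟩ := (isIrrAlg_submodule (span ℂ (Set.range b))).subset_of_subset_sUnion
        hCfin (fun T hT => (hC T hT).2.1)
        (hZC ▸ (Set.subset_biUnion_of_mem (u := fun b => (span ℂ (Set.range b) : Set (ι → ℂ)))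
          hb).trans (subset_zcl Z))
      have hTZ : T ⊆ zcl Z := hZC ▸ Set.subset_sUnion_of_mem hTC
      rcases (he b hb).span_eq_or_eq hY hdim (hC T hTC) hbT (hTZ.trans hZY) with h | h
      · exact h ▸ hTC
      · exact absurd (hZY.antisymm (h ▸ hTZ)) hne
    refine hA (Set.Finite.of_finite_image (hCfin.subset (Set.image_subset_iff.2 hspan)) ?_)
    intro b hb b' hb' h
    exact (he b' hb').eq_of_span_eq (he b hb) (SetLike.coe_injective h)
  have hclosed : IsAlgSet ((fun z => a • y + LinearMap.id (R := ℂ) z) ⁻¹' Y) :=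
    hY.2.1.preimage (isPolyMap_const_add _ _)
  have hsub : Z ⊆ (fun z => a • y + LinearMap.id (R := ℂ) z) ⁻¹' Y := by
    refine Set.iUnion₂_subset fun b hb x hx => hAY b hb ?_
    exact add_mem (smul_mem _ _ (hy b hb)) hx
  have := zcl_subset hclosed hsub (hZeq ▸ hz)
  rwa [add_comm]

end Frames

section Pluecker

variable {ι : Type*} {m : ℕ}

lemma isPolyMap_multilinear [Finite ι] {M : Type*} [AddCommGroup M] [Module ℂ M]
    (g : MultilinearMap ℂ (fun _ : Fin m => ι → ℂ) M) : IsPolyMap g := by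
  intro f
  have := Fintype.ofFinite ι
  classical
  have h : (fun b => f (g b)) = ∑ k : Fin m → ι,
      (fun _ => f (g fun i => Pi.single (k i) 1)) * ∏ i, fun b : Fin m → ι → ℂ => b i (k i) := by
    ext b
    have hb : b = fun i => ∑ k, b i k • Pi.single k 1 := funext fun i => pi_eq_sum_univ' (b i)
    conv_lhs => rw [hb]
    simp [MultilinearMap.map_sum, MultilinearMap.map_smul_univ, mul_comm]
  rw [h]
  refine sum_mem fun k _ => mul_mem (const_mem_polyFun _) (prod_mem fun i _ => ?_)
  exact linear_mem_polyFun ((LinearMap.proj (R := ℂ) (φ := fun _ => ℂ) (k i)).comp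
    (LinearMap.proj (φ := fun _ => ι → ℂ) i))

lemma exists_smul_eq_of_mem_span {V M : Type*} [AddCommGroup V] [Module ℂ V] [AddCommGroup M]
    [Module ℂ M] {b q : Fin m → V} (hb : LinearIndependent ℂ b)
    (hq : ∀ i, q i ∈ span ℂ (Set.range b)) (g : V [⋀^Fin m]→ₗ[ℂ] M) : ∃ t : ℂ, g q = t • g b := by
  let B := Module.Basis.span hb
  let G := g.compLinearMap (span ℂ (Set.range b)).subtype
  have hG : G = (LinearMap.toSpanSingleton ℂ M (G B)).compAlternatingMap B.det := by
    refine Module.Basis.ext_alternating B fun i h => ?_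
    let σ : Equiv.Perm (Fin m) := Equiv.ofBijective i (Finite.injective_iff_bijective.1 h)
    change G (B ∘ σ) = (LinearMap.toSpanSingleton ℂ M (G B)).compAlternatingMap B.det (B ∘ σ)
    simp [AlternatingMap.map_perm, Module.Basis.det_self]
  have hB : G B = g b := congrArg g (funext fun i => by simp [B, Module.Basis.span_apply])
  refine ⟨B.det fun i => ⟨q i, hq i⟩, ?_⟩
  simpa [hB] using! DFunLike.congr_fun hG fun i => ⟨q i, hq i⟩

lemma exists_isNormalized_span_eq [Finite ι] {U : Submodule ℂ (ι → ℂ)}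
    (hU : Module.finrank ℂ U = m) :
    ∃ (e : Fin m → ι) (b : Fin m → ι → ℂ), IsNormalized e b ∧ span ℂ (Set.range b) = U := by
  let r (k : ι) : Module.Dual ℂ U := (LinearMap.proj k).comp U.subtype
  obtain ⟨f, hf, hspan, -⟩ := exists_fun_fin_finrank_span_eq ℂ (Set.range r)
  choose e he using hf
  let ψ : U →ₗ[ℂ] Fin (Module.finrank ℂ (span ℂ (Set.range r))) → ℂ := LinearMap.pi f
  have hinj : Function.Injective ψ := by
    rw [injective_iff_map_eq_zero]
    intro x hx
    have hle : span ℂ (Set.range f) ≤ LinearMap.ker (Module.Dual.eval ℂ U x) := by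
      rw [span_le]
      rintro _ ⟨i, rfl⟩
      exact congrFun hx i
    rw [hspan] at hle
    ext k
    exact hle (subset_span ⟨k, rfl⟩)
  have hrank : Module.finrank ℂ (span ℂ (Set.range r)) = m := by
    refine le_antisymm ?_ ?_
    · rw [← hU, ← Subspace.dual_finrank_eq (K := ℂ) (V := U)]
      exact Submodule.finrank_le (span ℂ (Set.range r))
    · simpa [hU] using LinearMap.finrank_le_finrank_of_injective hinj
  generalize Module.finrank ℂ (span ℂ (Set.range r)) = d at *
  subst hrank
  let Ψ := LinearEquiv.ofInjectiveOfFinrankEq ψ hinj (by simp [hU])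
  have hnorm : IsNormalized e fun i => (Ψ.symm (Pi.single i 1)).1 := by
    intro i j
    have : f j (Ψ.symm (Pi.single i (1 : ℂ))) = (Pi.single i 1 : Fin _ → ℂ) j :=
      congrFun (Ψ.apply_symm_apply (Pi.single i 1)) j
    rw [← he] at this
    rw [Pi.single_apply] at this
    simpa [r, eq_comm] using! this
  refine ⟨e, _, hnorm, Submodule.eq_of_le_of_finrank_eq ?_ ?_⟩
  · rw [span_le]
    rintro _ ⟨i, rfl⟩
    exact (Ψ.symm _).2
  · rw [finrank_span_eq_card hnorm.linearIndependent, hU, Fintype.card_fin]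

/-- The normalized frames whose span is contained in `Y`. -/
def frames (e : Fin m → ι) (Y : Set (ι → ℂ)) : Set (Fin m → ι → ℂ) :=
  {b | IsNormalized e b ∧ (span ℂ (Set.range b) : Set (ι → ℂ)) ⊆ Y}

lemma isAlgSet_frames (e : Fin m → ι) {Y : Set (ι → ℂ)} (hY : IsAlgSet Y) :
    IsAlgSet (frames e Y) := by
  have h : frames e Y = (⋂ i, ⋂ j, (fun b : Fin m → ι → ℂ => b i) ⁻¹'
      {w | w (e j) = if i = j then 1 else 0}) ∩ ⋂ u, combine (ι → ℂ) u ⁻¹' Y := by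
    ext b
    simp only [frames, IsNormalized, Set.subset_def, SetLike.mem_coe, mem_span_range_iff_combine,
      Set.mem_inter_iff, Set.mem_iInter, Set.mem_preimage, Set.mem_ofPred_eq,
      forall_exists_index, forall_apply_eq_imp_iff]
  rw [h]
  refine IsAlgSet.inter (isAlgSet_iInter fun i => isAlgSet_iInter fun j => ?_)
    (isAlgSet_iInter fun u => hY.preimage (isPolyMap_linear _))
  exact (isAlgSet_coord _ _).preimage
    (isPolyMap_linear (LinearMap.proj (R := ℂ) (φ := fun _ => ι → ℂ) i))

theorem exists_component_two_le_trdeg [Finite ι] {Y : Set (ι → ℂ)} (hY : IsAlgSet Y)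
    {R : Set (Submodule ℂ (ι → ℂ))}
    (hR : ∀ U ∈ R, Module.finrank ℂ U = m ∧ (U : Set (ι → ℂ)) ⊆ Y)
    (hdim : 2 < adim (zcl {w : ExteriorAlgebra ℂ (ι → ℂ) | ∃ U ∈ R, ∃ q : Fin m → ι → ℂ,
      (∀ j, q j ∈ U) ∧ w = ExteriorAlgebra.ιMulti ℂ m q})) :
    ∃ e : Fin m → ι, ∃ X ⊆ frames e Y, IsIrrAlg X ∧ 2 ≤ Algebra.trdeg ℂ (CoordRing X) := by
  obtain ⟨n, hn, Z, hZ, hchain⟩ := exists_hasChain_of_lt_adim (n := 2) (by exact_mod_cast hdim)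
  obtain ⟨f, hf, hind⟩ := hchain.exists_independent
  by_contra! hcon
  choose C hCfin hC hCeq using fun e : Fin m → ι =>
    exists_finite_irreducible_decomposition (isAlgSet_frames e hY)
  have hrel : ∀ e, ∀ X ∈ C e, ∃ P : MvPolynomial (Fin n) ℂ, P ≠ 0 ∧ ∀ b ∈ X, ∀ t : ℂ,
      MvPolynomial.eval (fun i => f i (t • ExteriorAlgebra.ιMulti ℂ m b)) P = 0 := by
    intro e X hX
    by_contra! hP
    refine (hcon e X (hCeq e ▸ Set.subset_sUnion_of_mem hX) (hC e X hX)).not_ge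
      (two_le_trdeg_coordRing (hC e X hX).isPreIrr
        (isPolyMap_multilinear (ExteriorAlgebra.ιMulti ℂ m).toMultilinearMap) hn hf
        fun P hP0 => ?_)
    by_contra hne
    obtain ⟨b, hb, t, ht⟩ := hP P hne
    exact ht (hP0 b hb t)
  choose! P hP0 hP using hrel
  have := Fintype.ofFinite (Fin m → ι)
  have hQ : ∏ e, ∏ X ∈ (hCfin e).toFinset, P e X ≠ 0 :=
    Finset.prod_ne_zero_iff.2 fun e _ => Finset.prod_ne_zero_iff.2 fun X hX =>
      hP0 e X (by simpa using hX)
  refine hQ (hind _ fun x hx => ?_)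
  refine eq_zero_on_zcl (eval_mem_polyFun hf _) ?_ x (hZ hx)
  rintro _ ⟨U, hU, q, hq, rfl⟩
  obtain ⟨e, b, hb, rfl⟩ := exists_isNormalized_span_eq (hR U hU).1
  obtain ⟨t, ht⟩ := exists_smul_eq_of_mem_span hb.linearIndependent hq
    (ExteriorAlgebra.ιMulti ℂ m)
  have hbmem : b ∈ ⋃₀ C e := hCeq e ▸ ⟨hb, (hR _ hU).2⟩
  obtain ⟨X, hX, hbX⟩ := hbmem
  rw [map_prod]
  refine Finset.prod_eq_zero (Finset.mem_univ e) ?_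
  rw [map_prod]
  refine Finset.prod_eq_zero (i := X) (by simpa using hX) ?_
  rw [ht]
  exact hP e X hX b hbX t

end Pluecker

section Main

variable {ι : Type*} {m : ℕ}

theorem eq_submodule_of_two_le_trdeg [Finite ι] {Y : Set (ι → ℂ)} (hY : IsIrrAlg Y)
    (hdim : adim Y ≤ (m + 1 : ℕ)) {e : Fin m → ι} {X : Set (Fin m → ι → ℂ)} (hX : IsIrrAlg X)
    (hXY : X ⊆ frames e Y) (htr : 2 ≤ Algebra.trdeg ℂ (CoordRing X)) :
    ∃ L : Submodule ℂ (ι → ℂ), Module.finrank ℂ L = m + 1 ∧ Y = (L : Set (ι → ℂ)) := by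
  obtain ⟨i, k, hnc⟩ : ∃ i k, ¬ ∃ c, ∀ b ∈ X, b i k = c := by
    by_contra! hcon
    choose! c hc using hcon
    have h0 := trdeg_coordRing_of_subsingleton hX.isPreIrr fun b hb b' hb' =>
      funext fun i => funext fun k => (hc i k b hb).trans (hc i k b' hb').symm
    rw [h0] at htr
    simp at htr
  have hcoord (i : Fin m) (k : ι) : (fun b : Fin m → ι → ℂ => b i k) ∈ PolyFun _ :=
    linear_mem_polyFun ((LinearMap.proj (R := ℂ) (φ := fun _ => ℂ) k).comp
      (LinearMap.proj (φ := fun _ => ι → ℂ) i))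
  obtain ⟨c, hc⟩ := exists_infinite_fibre hX htr (hcoord i k) hnc
  have hD := finite_coord_fibre hX.isPreIrr (fun b hb => (hXY hb).1) (fun b hb => (hXY hb).2)
    hY.2.1 hdim (u := Pi.single i 1) (by simpa only [combine_single] using hnc) c
  simp_rw [combine_single] at hD
  obtain ⟨y, hyc⟩ : ∃ y, {b ∈ X | b i = y}.Infinite := by
    by_contra! hcon
    refine hc ((hD.biUnion fun y _ => hcon y).subset ?_)
    rintro b ⟨hb, hbc⟩
    exact Set.mem_biUnion ⟨subset_zcl _ ⟨b, hb, rfl⟩, hbc⟩ ⟨hb, rfl⟩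
  have hadd : ∀ z ∈ Y, ∀ a : ℂ, z + a • y ∈ Y := fun z hz => by
    refine add_smul_mem_of_infinite hY hdim hyc (fun b hb => (hXY hb.1).1)
      (fun b hb => (hXY hb.1).2) ?_ hz
    rintro b ⟨hb, rfl⟩
    exact subset_span ⟨i, rfl⟩
  obtain ⟨b₀, hb₀, hb₀y⟩ := hyc.nonempty
  obtain ⟨b, hb, hyb⟩ : ∃ b ∈ X, y ∉ span ℂ (Set.range b) := by
    by_contra! hcon
    refine hnc ⟨y k, fun b hb => ?_⟩
    subst hb₀y
    rw [(hXY hb).1.eq_of_mem_span (hXY hb₀).1 (hcon b hb)]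
  refine ⟨span ℂ (Set.range b) ⊔ span ℂ {y}, ?_, ?_⟩
  · rw [finrank_sup_span_singleton hyb, finrank_span_eq_card (hXY hb).1.linearIndependent,
      Fintype.card_fin]
  · have hsub : ((span ℂ (Set.range b) ⊔ span ℂ {y} : Submodule ℂ (ι → ℂ)) : Set (ι → ℂ)) ⊆ Y := by
      intro x hx
      obtain ⟨z, hz, w, hw, rfl⟩ := mem_sup.1 hx
      obtain ⟨a, rfl⟩ := mem_span_singleton.1 hw
      exact hadd z ((hXY hb).2 hz) a
    rcases (hXY hb).1.span_eq_or_eq hY hdim (isIrrAlg_submodule _)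
      (SetLike.coe_subset_coe.2 le_sup_left) hsub with h | h
    · exact absurd (SetLike.coe_injective h ▸ mem_sup_right (mem_span_singleton_self y)) hyb
    · exact h.symm

end Main
end ZariskiGeometry
/-- An irreducible projective variety of dimension `m ≥ 2` containing an irreducible
2-dimensional family of linear subspaces of dimension `m - 1` is itself a linear
space (of dimension `m`). The family is measured via its cone of Plücker points. -/
theorem linear_of_family_of_hyperplanes (N m : ℕ) (hm : 2 ≤ m)
    (Y : Set (Fin (N + 1) → ℂ)) (hY : IsProjVar Y) (hdim : pdim Y = (m : ℕ∞))
    (R : Set (Submodule ℂ (Fin (N + 1) → ℂ)))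
    (hR : ∀ U ∈ R, Module.finrank ℂ U = m ∧ (U : Set (Fin (N + 1) → ℂ)) ⊆ Y)
    (hRirr : IsIrrAlg (zcl {w : ExteriorAlgebra ℂ (Fin (N + 1) → ℂ) |
      ∃ U ∈ R, ∃ q : Fin m → Fin (N + 1) → ℂ, (∀ j, q j ∈ U) ∧
        w = ExteriorAlgebra.ιMulti ℂ m q}))
    (hRdim : pdim (zcl {w : ExteriorAlgebra ℂ (Fin (N + 1) → ℂ) |
      ∃ U ∈ R, ∃ q : Fin m → Fin (N + 1) → ℂ, (∀ j, q j ∈ U) ∧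
        w = ExteriorAlgebra.ιMulti ℂ m q}) = 2) :
    ∃ L : Submodule ℂ (Fin (N + 1) → ℂ), Module.finrank ℂ L = m + 1 ∧
      Y = (L : Set (Fin (N + 1) → ℂ)) := by
  have hdim' : adim Y ≤ (m + 1 : ℕ) := by
    rw [Nat.cast_add, Nat.cast_one, ← tsub_le_iff_right]
    exact hdim.le
  obtain ⟨e, X, hXY, hX, htr⟩ := ZariskiGeometry.exists_component_two_le_trdeg hY.1 hR (by
    by_contra! hle
    have := hRdim.symm.le.trans (tsub_le_tsub_right hle 1)
    exact absurd (show (2 : ℕ) ≤ 2 - 1 by exact_mod_cast this) (by norm_num))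
  exact ZariskiGeometry.eq_submodule_of_two_le_trdeg hY.2.2.1 hdim' hX hXY htr
end
end
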